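/- arXiv:0806.3310 — 6 statements merged into one kernel-verified Lean document; each statement's English description precedes it below -/
import Mathlib

section
/- Quaternionic Gauss theorem (ball case): Let c ∈ ℍ, R > 0, and let f₀, f₁, f₂, f₃ : ℍ → ℍ be continuously differentiable on a neighborhood of the closed ball of radius R centered at c in ℍ ≅ ℝ⁴. Writing each unit quaternion ω ∈ S³ as ω = n₀ + n₁i + n₂j + n₃k, one has R³·∫_{ω∈S³} ( n₀·f₀(c+Rω) + n₁·f₁(c+Rω) + n₂·f₂(c+Rω) + n₃·f₃(c+Rω) ) dσ(ω) = ∫_{B(c,R)} ( ∂f₀/∂t + ∂f₁/∂x + ∂f₂/∂y + ∂f₃/∂z ) dV, i.e. the surface integral over the sphere ∂B(c,R), with outward unit normal (n₀,n₁,n₂,n₃) = ω, of n₀f₀ + n₁f₁ + n₂f₂ + n₃f₃ equals the volume integral over the ball of the divergence. -/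
open MeasureTheory Metric Filter
open scoped Quaternion Topology

noncomputable section

/-- Borel measurable structure on the quaternions `ℍ ≅ ℝ⁴`. -/
instance : MeasurableSpace ℍ[ℝ] := borel _
instance : BorelSpace ℍ[ℝ] := ⟨rfl⟩

/-- Lebesgue measure on `ℍ ≅ ℝ⁴`, i.e. the Haar measure normalized so that the unit cube
of an orthonormal basis has volume one. -/
instance : MeasureSpace ℍ[ℝ] := ⟨(stdOrthonormalBasis ℝ ℍ[ℝ]).toBasis.addHaar⟩

/-- The imaginary unit `i` of `ℍ`. -/
def qI : ℍ[ℝ] := ⟨0, 1, 0, 0⟩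
/-- The imaginary unit `j` of `ℍ`. -/
def qJ : ℍ[ℝ] := ⟨0, 0, 1, 0⟩
/-- The imaginary unit `k` of `ℍ`. -/
def qK : ℍ[ℝ] := ⟨0, 0, 0, 1⟩

/-- The left Fueter operator `D_l f = ∂f/∂t + i·∂f/∂x + j·∂f/∂y + k·∂f/∂z`. -/
def Dl (f : ℍ[ℝ] → ℍ[ℝ]) (q : ℍ[ℝ]) : ℍ[ℝ] :=
  fderiv ℝ f q 1 + qI * fderiv ℝ f q qI + qJ * fderiv ℝ f q qJ + qK * fderiv ℝ f q qK

/-- The right Fueter operator `D_r f = ∂f/∂t + (∂f/∂x)·i + (∂f/∂y)·j + (∂f/∂z)·k`. -/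
def Dr (f : ℍ[ℝ] → ℍ[ℝ]) (q : ℍ[ℝ]) : ℍ[ℝ] :=
  fderiv ℝ f q 1 + fderiv ℝ f q qI * qI + fderiv ℝ f q qJ * qJ + fderiv ℝ f q qK * qK

/-- The Cauchy–Fueter kernel `E(q,p) = (1/(2π²))·(q−p)⁻¹/|q−p|²`. -/
def E (q p : ℍ[ℝ]) : ℍ[ℝ] := ((2 * Real.pi ^ 2)⁻¹ * (‖q - p‖ ^ 2)⁻¹) • (q - p)⁻¹

/-- A test function on a bounded open set `Ω ⊆ ℍ`: a smooth function with compact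
support contained in `Ω`. -/
structure IsTestFunction (φ : ℍ[ℝ] → ℍ[ℝ]) (Ω : Set ℍ[ℝ]) : Prop where
  smooth : ContDiff ℝ (⊤ : ℕ∞) φ
  compact_supp : HasCompactSupport φ
  supp_subset : tsupport φ ⊆ Ω

section DivergenceBall

open Module (finrank)

open scoped RealInnerProductSpace

variable {V F : Type*} [NormedAddCommGroup V] [InnerProductSpace ℝ V]
  [NormedAddCommGroup F] [NormedSpace ℝ F]

/-- A `C¹` radial profile that vanishes near the origin gives a `C¹` radial function. -/
theorem contDiff_comp_norm {G : ℝ → ℝ} (hG : ContDiff ℝ 1 G) {a : ℝ} (ha : 0 < a)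
    (hGa : ∀ r ≤ a, G r = 0) : ContDiff ℝ 1 (fun x : V ↦ G ‖x‖) := by
  rw [contDiff_iff_contDiffAt]
  intro x
  rcases eq_or_ne x 0 with rfl | hx
  · refine (contDiffAt_const (c := (0 : ℝ))).congr_of_eventuallyEq ?_
    filter_upwards [ball_mem_nhds (0 : V) ha] with y hy
    exact hGa _ (mem_ball_zero_iff.1 hy).le
  · exact hG.contDiffAt.comp x (contDiffAt_norm ℝ hx)

theorem fderiv_comp_norm_smul {G : ℝ → ℝ} (hG : Differentiable ℝ G) {r : ℝ} (hr : 0 < r)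
    {ω : V} (hω : ‖ω‖ = 1) (v : V) :
    fderiv ℝ (fun x : V ↦ G ‖x‖) (r • ω) v = deriv G r * ⟪ω, v⟫ := by
  have hne : r • ω ≠ 0 := smul_ne_zero hr.ne' (norm_ne_zero_iff.1 (by simp [hω]))
  have hnorm : ‖r • ω‖ = r := by simp [norm_smul, hω, abs_of_pos hr]
  have h1 : HasFDerivAt (fun x : V ↦ ‖x‖) (fderiv ℝ (fun x : V ↦ ‖x‖) (r • ω)) (r • ω) :=
    ((contDiffAt_norm ℝ (n := 1) hne).differentiableAt one_ne_zero).hasFDerivAt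
  have h2 := DFunLike.congr_fun
    ((h1.pow 2).unique (hasStrictFDerivAt_norm_sq (r • ω)).hasFDerivAt) v
  have h3 : fderiv ℝ (fun x : V ↦ ‖x‖) (r • ω) v = ⟪ω, v⟫ := by
    simp only [hnorm, smul_apply, nsmul_eq_mul, smul_eq_mul,
      innerSL_apply_apply, real_inner_smul_left] at h2
    have : r * fderiv ℝ (fun x : V ↦ ‖x‖) (r • ω) v = r * ⟪ω, v⟫ := by
      norm_num at h2
      linarith
    exact mul_left_cancel₀ hr.ne' this
  have h4 := ((hG ‖r • ω‖).hasDerivAt.comp_hasFDerivAt (r • ω) h1).fderiv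
  rw [Function.comp_def] at h4
  rw [h4, hnorm, smul_apply, h3, smul_eq_mul]

variable [FiniteDimensional ℝ V] [MeasurableSpace V] [BorelSpace V]

/-- Integration in polar coordinates. -/
theorem integral_eq_integral_Ioi_integral_sphere [Nontrivial V] (μ : Measure V)
    [μ.IsAddHaarMeasure] {g : V → F} (hg : Integrable g μ) :
    ∫ x, g x ∂μ = ∫ r in Set.Ioi (0 : ℝ), r ^ (finrank ℝ V - 1) •
      ∫ ω : sphere (0 : V) 1, g (r • (ω : V)) ∂μ.toSphere := by
  have hmp := μ.measurePreserving_homeomorphUnitSphereProd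
  have hemb := (homeomorphUnitSphereProd V).measurableEmbedding
  let k : sphere (0 : V) 1 × Set.Ioi (0 : ℝ) → F := fun p ↦ g ((p.2 : ℝ) • (p.1 : V))
  have hk : ∀ x : ({0}ᶜ : Set V), k (homeomorphUnitSphereProd V x) = g x := fun x ↦ by
    have hx : ‖(x : V)‖ ≠ 0 := norm_ne_zero_iff.2 x.2
    simp [k, smul_smul, hx]
  have hkint : Integrable k (μ.toSphere.prod (Measure.volumeIoiPow (finrank ℝ V - 1))) := by
    rw [← hmp.integrable_comp_emb hemb]
    have h := (integrableOn_iff_comap_subtypeVal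
      (measurableSet_singleton (0 : V)).compl).1 hg.integrableOn
    exact h.congr (.of_forall fun x ↦ (hk x).symm)
  calc
    ∫ x, g x ∂μ = ∫ x : ({0}ᶜ : Set V), g x ∂(μ.comap (↑)) := by
      rw [integral_subtype_comap (measurableSet_singleton _).compl g,
        restrict_compl_singleton]
    _ = ∫ p, k p ∂μ.toSphere.prod (Measure.volumeIoiPow (finrank ℝ V - 1)) := by
      rw [← hmp.integral_comp hemb]
      exact integral_congr_ae (.of_forall fun x ↦ (hk x).symm)
    _ = ∫ r : Set.Ioi (0 : ℝ), ∫ ω : sphere (0 : V) 1, g ((r : ℝ) • (ω : V)) ∂μ.toSphere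
          ∂Measure.volumeIoiPow (finrank ℝ V - 1) := integral_prod_symm _ hkint
    _ = _ := by
      simp only [Measure.volumeIoiPow, ENNReal.ofReal]
      rw [integral_withDensity_eq_integral_smul,
        integral_subtype_comap measurableSet_Ioi fun a ↦ Real.toNNReal (a ^ (finrank ℝ V - 1)) •
          ∫ ω : sphere (0 : V) 1, g (a • (ω : V)) ∂μ.toSphere,
        setIntegral_congr_fun measurableSet_Ioi fun x hx ↦ ?_]
      · rw [NNReal.smul_def, Real.coe_toNNReal _ (pow_nonneg hx.out.le _)]
      · exact (measurable_subtype_coe.pow_const _).real_toNNReal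

/-- Integration by parts against a radial weight, in polar coordinates. -/
theorem integral_comp_norm_smul_fderiv [Nontrivial V] (μ : Measure V)
    [μ.IsAddHaarMeasure] {f : V → F} (hf : ContDiff ℝ 1 f) (hfc : HasCompactSupport f)
    {G : ℝ → ℝ} (hG : ContDiff ℝ 1 G) {a : ℝ} (ha : 0 < a) (hGa : ∀ r ≤ a, G r = 0) (v : V) :
    ∫ x, G ‖x‖ • fderiv ℝ f x v ∂μ = -∫ r in Set.Ioi (0 : ℝ), deriv G r •
      r ^ (finrank ℝ V - 1) • ∫ ω : sphere (0 : V) 1, ⟪(ω : V), v⟫ • f (r • (ω : V))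
        ∂μ.toSphere := by
  have hφ := contDiff_comp_norm (V := V) hG ha hGa
  have hφ' : Continuous fun x ↦ fderiv ℝ (fun x : V ↦ G ‖x‖) x v :=
    (hφ.continuous_fderiv one_ne_zero).clm_apply continuous_const
  have hf' : Continuous fun x ↦ fderiv ℝ f x v :=
    (hf.continuous_fderiv one_ne_zero).clm_apply continuous_const
  have hint : Integrable (fun x ↦ fderiv ℝ (fun x : V ↦ G ‖x‖) x v • f x) μ :=
    (hφ'.smul hf.continuous).integrable_of_hasCompactSupport hfc.smul_left
  rw [integral_smul_fderiv_eq_neg_fderiv_smul_of_integrable hint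
    ((hφ.continuous.smul hf').integrable_of_hasCompactSupport (hfc.fderiv_apply ℝ v).smul_left)
    ((hφ.continuous.smul hf.continuous).integrable_of_hasCompactSupport hfc.smul_left)
    (fun x _ ↦ (hφ.differentiable one_ne_zero) x) (fun x _ ↦ (hf.differentiable one_ne_zero) x),
    integral_eq_integral_Ioi_integral_sphere μ hint]
  congr 1
  refine setIntegral_congr_fun measurableSet_Ioi fun r hr ↦ ?_
  rw [smul_comm (deriv G r), ← integral_smul (deriv G r)]
  congr 1
  refine integral_congr_ae (.of_forall fun ω ↦ ?_)
  dsimp only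
  rw [fderiv_comp_norm_smul (hG.differentiable one_ne_zero) hr (by simp) v, mul_smul]

theorem continuous_integral_sphere_smul (μ : Measure V) [μ.IsAddHaarMeasure]
    {f : V → F} (hf : Continuous f) (v : V) :
    Continuous fun r : ℝ ↦
      ∫ ω : sphere (0 : V) 1, ⟪(ω : V), v⟫ • f (r • (ω : V)) ∂μ.toSphere := by
  have h := continuous_parametric_integral_of_continuous (μ := μ.toSphere) (s := Set.univ)
    (f := fun (r : ℝ) (ω : sphere (0 : V) 1) ↦ ⟪(ω : V), v⟫ • f (r • (ω : V)))
    (by simp only [Function.uncurry_def]; fun_prop) isCompact_univ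
  simpa using h

theorem integral_sphere_inner_smul_eq_of_hasCompactSupport [Nontrivial V] (μ : Measure V)
    [μ.IsAddHaarMeasure] [CompleteSpace F]
    {f : V → F} (hf : ContDiff ℝ 1 f) (hfc : HasCompactSupport f) (v : V) {R : ℝ} (hR : 0 < R) :
    R ^ (finrank ℝ V - 1) • ∫ ω : sphere (0 : V) 1, ⟪(ω : V), v⟫ • f (R • (ω : V)) ∂μ.toSphere =
      ∫ x in ball 0 R, fderiv ℝ f x v ∂μ := by
  set H : ℝ → F := fun r ↦ r ^ (finrank ℝ V - 1) •
    ∫ ω : sphere (0 : V) 1, ⟪(ω : V), v⟫ • f (r • (ω : V)) ∂μ.toSphere with hH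
  have hHc : Continuous H :=
    (continuous_id.pow _).smul (continuous_integral_sphere_smul μ hf.continuous v)
  set s := Real.smoothTransition
  have hs : ContDiff ℝ 1 s := Real.smoothTransition.contDiff
  have hs' : Continuous (deriv s) := hs.continuous_deriv le_rfl
  have hf' : Continuous fun x ↦ fderiv ℝ f x v :=
    (hf.continuous_fderiv one_ne_zero).clm_apply continuous_const
  have hint : Integrable (fun x ↦ fderiv ℝ f x v) μ :=
    hf'.integrable_of_hasCompactSupport (hfc.fderiv_apply ℝ v)
  have hd0 : ∀ t, t ∉ Set.Ioc (0 : ℝ) 1 → deriv s t = 0 := by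
    intro t ht
    by_cases h0 : t ≤ 0
    · have : IsLocalMin s t := .of_forall fun y ↦ by
        rw [show s t = 0 from Real.smoothTransition.zero_of_nonpos h0]
        exact Real.smoothTransition.nonneg y
      exact this.deriv_eq_zero
    · have h1 : 1 ≤ t := by
        by_contra! h
        exact ht ⟨not_le.1 h0, h.le⟩
      have : IsLocalMax s t := .of_forall fun y ↦ by
        rw [show s t = 1 from Real.smoothTransition.one_of_one_le h1]
        exact Real.smoothTransition.le_one y
      exact this.deriv_eq_zero
  have key : ∀ ε > 0, ∫ x, s ((‖x‖ - R) / ε) • fderiv ℝ f x v ∂μ =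
      -∫ u in (0 : ℝ)..1, deriv s u • H (R + ε * u) := by
    intro ε hε
    have hG : ContDiff ℝ 1 fun r ↦ s ((r - R) / ε) := by fun_prop
    have hGd : ∀ r, deriv (fun r ↦ s ((r - R) / ε)) r = deriv s ((r - R) / ε) * ε⁻¹ := by
      intro r
      have h1 : HasDerivAt (fun r ↦ (r - R) / ε) ε⁻¹ r := by
        simpa using ((hasDerivAt_id r).sub_const R).div_const ε
      exact (((hs.differentiable one_ne_zero) _).hasDerivAt.comp r h1).deriv
    rw [integral_comp_norm_smul_fderiv μ hf hfc hG hR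
      (fun r hr ↦ Real.smoothTransition.zero_of_nonpos
        (div_nonpos_of_nonpos_of_nonneg (by linarith) hε.le)) v]
    congr 1
    have hsub := intervalIntegral.smul_integral_comp_add_mul (a := 0) (b := 1)
      (fun r ↦ (deriv s ((r - R) / ε) * ε⁻¹) • H r) ε R
    simp only [add_sub_cancel_left, mul_div_cancel_left₀ _ hε.ne', mul_zero, add_zero,
      mul_one] at hsub
    rw [← intervalIntegral.integral_smul] at hsub
    simp only [smul_smul] at hsub
    have hc : ∀ u, ε * (deriv s u * ε⁻¹) = deriv s u := fun u ↦ by field_simp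
    simp only [hc] at hsub
    rw [hsub, intervalIntegral.integral_of_le (by linarith)]
    simp only [hGd]
    refine setIntegral_eq_of_subset_of_forall_sdiff_eq_zero measurableSet_Ioi
      (fun r hr ↦ hR.trans hr.1) fun r hr ↦ ?_
    rw [hd0, zero_mul, zero_smul]
    rintro ⟨h1, h2⟩
    refine hr.2 ⟨?_, ?_⟩
    · have := (div_pos_iff_of_pos_right hε).1 h1
      linarith
    · have := (div_le_one hε).1 h2
      linarith
  have hlim1 : Tendsto (fun ε : ℝ ↦ ∫ x, s ((‖x‖ - R) / ε) • fderiv ℝ f x v ∂μ) (𝓝[>] 0)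
      (𝓝 (∫ x, (closedBall (0 : V) R)ᶜ.indicator (fun x ↦ fderiv ℝ f x v) x ∂μ)) := by
    refine tendsto_integral_filter_of_dominated_convergence (fun x ↦ ‖fderiv ℝ f x v‖)
      (.of_forall fun ε ↦ ?_) (.of_forall fun ε ↦ .of_forall fun x ↦ ?_) hint.norm
      (.of_forall fun x ↦ ?_)
    · have := hs.continuous
      exact Continuous.aestronglyMeasurable (by fun_prop)
    · rw [norm_smul, Real.norm_of_nonneg (Real.smoothTransition.nonneg _)]
      exact mul_le_of_le_one_left (norm_nonneg _) (Real.smoothTransition.le_one _)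
    · by_cases hx : ‖x‖ ≤ R
      · refine tendsto_const_nhds.congr' ?_
        filter_upwards [self_mem_nhdsWithin] with ε hε
        rw [show s ((‖x‖ - R) / ε) = 0 from Real.smoothTransition.zero_of_nonpos
          (div_nonpos_of_nonpos_of_nonneg (by linarith) (le_of_lt hε)), zero_smul]
        simp [hx]
      · refine tendsto_const_nhds.congr' ?_
        have hx' : 0 < ‖x‖ - R := by linarith
        filter_upwards [Ioc_mem_nhdsGT hx'] with ε hε
        rw [show s ((‖x‖ - R) / ε) = 1 from Real.smoothTransition.one_of_one_le
          ((one_le_div hε.1).2 hε.2), one_smul]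
        simp [not_le.1 hx]
  have hlim2 : Tendsto (fun ε : ℝ ↦ -∫ u in (0 : ℝ)..1, deriv s u • H (R + ε * u)) (𝓝[>] 0)
      (𝓝 (-H R)) := by
    have hcont : Continuous fun ε : ℝ ↦ ∫ u in (0 : ℝ)..1, deriv s u • H (R + ε * u) :=
      intervalIntegral.continuous_parametric_intervalIntegral_of_continuous'
        (by simp only [Function.uncurry_def]; fun_prop) 0 1
    have h0 := (hcont.tendsto 0).mono_left (nhdsWithin_le_nhds (s := Set.Ioi (0 : ℝ)))
    simp only [zero_mul, add_zero, intervalIntegral.integral_smul_const] at h0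
    rw [intervalIntegral.integral_deriv_eq_sub
      (fun x _ ↦ (hs.differentiable one_ne_zero) x) (hs'.intervalIntegrable 0 1)] at h0
    simpa [s] using h0.neg
  have heq := tendsto_nhds_unique (hlim1.congr' (by
    filter_upwards [self_mem_nhdsWithin] with ε hε using key ε hε)) hlim2
  have hzero : ∫ x, fderiv ℝ f x v ∂μ = 0 := by
    have := integral_smul_fderiv_eq_neg_fderiv_smul_of_integrable (μ := μ) (𝕜 := ℝ)
      (f := fun _ : V ↦ (1 : ℝ)) (g := f) (v := v) (by simp) (by simpa using hint)
      (by simpa using hf.continuous.integrable_of_hasCompactSupport hfc)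
      (fun x _ ↦ by fun_prop) (fun x _ ↦ (hf.differentiable one_ne_zero) x)
    simpa using this
  rw [integral_indicator measurableSet_closedBall.compl] at heq
  have hsum := integral_add_compl (measurableSet_closedBall (x := (0 : V)) (ε := R)) hint
  rw [hzero, heq] at hsum
  have hball : ball (0 : V) R =ᵐ[μ] closedBall (0 : V) R := by
    rw [← ball_union_sphere]
    exact (union_ae_eq_left_of_ae_eq_empty
      (ae_eq_empty.2 (Measure.addHaar_sphere μ 0 R))).symm
  rw [setIntegral_congr_set hball]
  exact (add_neg_eq_zero.1 hsum).symm

/-- **Divergence theorem on a ball**, in the form of the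
`v`-component of the Gauss–Green formula. -/
theorem integral_sphere_inner_smul_eq [Nontrivial V] (μ : Measure V)
    [μ.IsAddHaarMeasure] [CompleteSpace F]
    {f : V → F} {c : V} {R : ℝ} (hR : 0 < R) {U : Set V} (hU : IsOpen U)
    (hUB : closedBall c R ⊆ U) (hf : ContDiffOn ℝ 1 f U) (v : V) :
    R ^ (finrank ℝ V - 1) •
        ∫ ω : sphere (0 : V) 1, ⟪(ω : V), v⟫ • f (c + R • (ω : V)) ∂μ.toSphere =
      ∫ x in ball c R, fderiv ℝ f x v ∂μ := by
  obtain ⟨δ, hδ, hδU⟩ := (isCompact_closedBall c R).exists_cthickening_subset_open hU hUB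
  rw [cthickening_closedBall hδ.le hR.le] at hδU
  let χ : ContDiffBump c := ⟨R + δ / 4, R + δ / 2, by linarith, by linarith⟩
  have hsupp : tsupport χ ⊆ U := by
    rw [χ.tsupport_eq]
    exact (closedBall_subset_closedBall (by simp only [χ]; linarith)).trans hδU
  have hone : ∀ x ∈ closedBall c R, (fun y ↦ χ y • f y) =ᶠ[𝓝 x] f := fun x hx ↦ by
    filter_upwards [isOpen_ball.mem_nhds
      (closedBall_subset_ball (show R < R + δ / 4 by linarith) hx)] with y hy
    rw [χ.one_of_mem_closedBall (ball_subset_closedBall hy), one_smul]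
  have hg : ContDiff ℝ 1 fun y ↦ χ y • f y := by
    rw [contDiff_iff_contDiffAt]
    intro x
    by_cases hx : x ∈ tsupport χ
    · exact χ.contDiff.contDiffAt.smul (hf.contDiffAt (hU.mem_nhds (hsupp hx)))
    · refine (contDiffAt_const (c := (0 : F))).congr_of_eventuallyEq ?_
      filter_upwards [(isClosed_tsupport χ).isOpen_compl.mem_nhds hx] with y hy
      rw [image_eq_zero_of_notMem_tsupport hy, zero_smul]
  have hgc : HasCompactSupport fun y ↦ χ y • f y := χ.hasCompactSupport.smul_right
  have hmain := integral_sphere_inner_smul_eq_of_hasCompactSupport μ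
    (f := fun x ↦ χ (c + x) • f (c + x)) (hg.comp (contDiff_const.add contDiff_id))
    (hgc.comp_homeomorph (Homeomorph.addLeft c)) v hR
  have hemb := (Homeomorph.addLeft c).measurableEmbedding
  have htrans := (measurePreserving_add_left μ c).setIntegral_preimage_emb hemb
    (fun x ↦ fderiv ℝ f x v) (ball c R)
  have hpre : (c + ·) ⁻¹' ball c R = ball (0 : V) R := by
    ext x; simp [mem_ball, dist_eq_norm]
  rw [hpre] at htrans
  rw [← htrans]
  convert hmain using 1
  · congr 1
    refine integral_congr_ae (.of_forall fun ω ↦ ?_)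
    dsimp only
    have := (hone (c + R • (ω : V)) (by simp [norm_smul, abs_of_pos hR])).eq_of_nhds
    rw [this]
  · refine setIntegral_congr_fun measurableSet_ball fun x hx ↦ ?_
    have hx' : c + x ∈ closedBall c R := by
      simpa [mem_closedBall, dist_eq_norm] using (mem_ball_zero_iff.1 hx).le
    have h1 := (hone _ hx').fderiv_eq (𝕜 := ℝ)
    rw [fderiv_comp_add_left (f := fun y ↦ χ y • f y) c, h1]

end DivergenceBall

/-- **Quaternionic Gauss theorem (ball case).** The surface integral over `∂B(c,R)` of
`n₀f₀ + n₁f₁ + n₂f₂ + n₃f₃` (outward unit normal `ω = n₀ + n₁i + n₂j + n₃k`) equals the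
volume integral over `B(c,R)` of the divergence `∂f₀/∂t + ∂f₁/∂x + ∂f₂/∂y + ∂f₃/∂z`. -/
theorem quaternionic_gauss_ball (c : ℍ[ℝ]) (R : ℝ) (hR : 0 < R)
    (f₀ f₁ f₂ f₃ : ℍ[ℝ] → ℍ[ℝ]) (U : Set ℍ[ℝ]) (hU : IsOpen U)
    (hUB : closedBall c R ⊆ U)
    (h₀ : ContDiffOn ℝ 1 f₀ U) (h₁ : ContDiffOn ℝ 1 f₁ U)
    (h₂ : ContDiffOn ℝ 1 f₂ U) (h₃ : ContDiffOn ℝ 1 f₃ U) :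
    R ^ 3 • (∫ ω : sphere (0 : ℍ[ℝ]) 1,
        ((ω : ℍ[ℝ]).re • f₀ (c + R • (ω : ℍ[ℝ])) + (ω : ℍ[ℝ]).imI • f₁ (c + R • (ω : ℍ[ℝ]))
          + (ω : ℍ[ℝ]).imJ • f₂ (c + R • (ω : ℍ[ℝ]))
          + (ω : ℍ[ℝ]).imK • f₃ (c + R • (ω : ℍ[ℝ]))) ∂(volume : Measure ℍ[ℝ]).toSphere)
      = ∫ q in ball c R,
          (fderiv ℝ f₀ q 1 + fderiv ℝ f₁ q qI + fderiv ℝ f₂ q qJ + fderiv ℝ f₃ q qK) := by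
  have : (volume : Measure ℍ[ℝ]).IsAddHaarMeasure :=
    inferInstanceAs (stdOrthonormalBasis ℝ ℍ[ℝ]).toBasis.addHaar.IsAddHaarMeasure
  have hpt : Continuous fun ω : sphere (0 : ℍ[ℝ]) 1 ↦ c + R • (ω : ℍ[ℝ]) := by fun_prop
  have hmem : ∀ ω : sphere (0 : ℍ[ℝ]) 1, c + R • (ω : ℍ[ℝ]) ∈ U := fun ω ↦
    hUB (by simp [norm_smul, abs_of_pos hR])
  have hsphere : ∀ {f : ℍ[ℝ] → ℍ[ℝ]} (v : ℍ[ℝ]), ContDiffOn ℝ 1 f U →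
      Integrable (fun ω : sphere (0 : ℍ[ℝ]) 1 ↦ inner ℝ (ω : ℍ[ℝ]) v • f (c + R • (ω : ℍ[ℝ])))
        (volume : Measure ℍ[ℝ]).toSphere := fun v hf ↦ by
    have h := hf.continuousOn.comp_continuous hpt hmem
    exact ((continuous_subtype_val.inner (𝕜 := ℝ) continuous_const).smul
      h).integrable_of_hasCompactSupport
      (.of_compactSpace _)
  have hball : ∀ {f : ℍ[ℝ] → ℍ[ℝ]} (v : ℍ[ℝ]), ContDiffOn ℝ 1 f U →
      IntegrableOn (fun q ↦ fderiv ℝ f q v) (ball c R) := fun v hf ↦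
    ((((hf.continuousOn_fderiv_of_isOpen hU le_rfl).mono hUB).clm_apply
      continuousOn_const).integrableOn_compact (isCompact_closedBall c R)).mono_set
      ball_subset_closedBall
  have hre : ∀ q : ℍ[ℝ], q.re = inner ℝ q 1 := fun q ↦ by simp [Quaternion.inner_def]
  have hI : ∀ q : ℍ[ℝ], q.imI = inner ℝ q qI := fun q ↦ by
    simp only [Quaternion.inner_def, Quaternion.re_mul, Quaternion.re_star, Quaternion.imI_star,
      Quaternion.imJ_star, Quaternion.imK_star]
    simp [qI]
  have hJ : ∀ q : ℍ[ℝ], q.imJ = inner ℝ q qJ := fun q ↦ by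
    simp only [Quaternion.inner_def, Quaternion.re_mul, Quaternion.re_star, Quaternion.imI_star,
      Quaternion.imJ_star, Quaternion.imK_star]
    simp [qJ]
  have hK : ∀ q : ℍ[ℝ], q.imK = inner ℝ q qK := fun q ↦ by
    simp only [Quaternion.inner_def, Quaternion.re_mul, Quaternion.re_star, Quaternion.imI_star,
      Quaternion.imJ_star, Quaternion.imK_star]
    simp [qK]
  have hdiv : ∀ {f : ℍ[ℝ] → ℍ[ℝ]} (v : ℍ[ℝ]), ContDiffOn ℝ 1 f U →
      R ^ 3 • ∫ ω : sphere (0 : ℍ[ℝ]) 1, inner ℝ (ω : ℍ[ℝ]) v • f (c + R • (ω : ℍ[ℝ]))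
        ∂(volume : Measure ℍ[ℝ]).toSphere = ∫ q in ball c R, fderiv ℝ f q v := fun v hf ↦ by
    rw [← integral_sphere_inner_smul_eq volume hR hU hUB hf v, Quaternion.finrank_eq_four]
  simp only [hre, hI, hJ, hK]
  rw [integral_add (((hsphere 1 h₀).fun_add (hsphere qI h₁)).fun_add (hsphere qJ h₂))
      (hsphere qK h₃),
    integral_add ((hsphere 1 h₀).fun_add (hsphere qI h₁)) (hsphere qJ h₂),
    integral_add (hsphere 1 h₀) (hsphere qI h₁),
    integral_add (((hball 1 h₀).fun_add (hball qI h₁)).fun_add (hball qJ h₂)) (hball qK h₃),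
    integral_add ((hball 1 h₀).fun_add (hball qI h₁)) (hball qJ h₂),
    integral_add (hball 1 h₀) (hball qI h₁)]
  simp only [smul_add, hdiv _ h₀, hdiv _ h₁, hdiv _ h₂, hdiv _ h₃]
end
end

section
/- Quaternionic Green integral formula (ball case): Let c ∈ ℍ, R > 0, and let u, v : ℍ → ℍ be continuously differentiable on a neighborhood of the closed ball of radius R centered at c. Then ∫_{B(c,R)} ( (D_r u)(q)·v(q) + u(q)·(D_l v)(q) ) dV(q) = R³·∫_{ω∈S³} u(c+Rω)·ω·v(c+Rω) dσ(ω), where ω ∈ S³ ⊆ ℍ is the outward unit quaternion normal and all products are quaternion products. -/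
open MeasureTheory Metric Filter
open scoped Quaternion Topology

noncomputable section

/-- Integration in polar coordinates. -/
theorem integral_eq_setIntegral_Ioi_integral_sphere {E F : Type*} [NormedAddCommGroup E]
    [NormedSpace ℝ E] [FiniteDimensional ℝ E] [Nontrivial E] [MeasurableSpace E] [BorelSpace E]
    [NormedAddCommGroup F] [NormedSpace ℝ F]
    (μ : Measure E) [μ.IsAddHaarMeasure] {f : E → F} (hf : Integrable f μ) :
    ∫ x, f x ∂μ = ∫ r in Set.Ioi (0 : ℝ), r ^ (Module.finrank ℝ E - 1) •
      ∫ ω : sphere (0 : E) 1, f (r • (ω : E)) ∂μ.toSphere := by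
  have hmp := μ.measurePreserving_homeomorphUnitSphereProd
  have hemb := (homeomorphUnitSphereProd E).measurableEmbedding
  let g : sphere (0 : E) 1 × Set.Ioi (0 : ℝ) → F := fun p ↦ f ((p.2 : ℝ) • (p.1 : E))
  have hg (x : ({0}ᶜ : Set E)) : g (homeomorphUnitSphereProd E x) = f x := by
    have := homeomorphUnitSphereProd_symm_apply_coe E (homeomorphUnitSphereProd E x)
    rw [Homeomorph.symm_apply_apply] at this
    simp only [g, ← this]
  have hgi : Integrable g (μ.toSphere.prod (.volumeIoiPow (Module.finrank ℝ E - 1))) := by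
    rw [← hmp.integrable_comp_emb hemb]
    have : g ∘ homeomorphUnitSphereProd E = fun x : ({0}ᶜ : Set E) ↦ f x := funext hg
    rw [this]
    exact (integrableOn_iff_comap_subtypeVal (by measurability)).1 hf.integrableOn
  calc
    ∫ x, f x ∂μ = ∫ x : ({0}ᶜ : Set E), f x ∂(μ.comap (↑)) := by
      rw [integral_subtype_comap (measurableSet_singleton _).compl f,
        restrict_compl_singleton]
    _ = ∫ p, g p ∂μ.toSphere.prod (.volumeIoiPow (Module.finrank ℝ E - 1)) := by
      rw [← hmp.integral_comp hemb]
      exact integral_congr_ae (.of_forall fun x ↦ (hg x).symm)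
    _ = ∫ r : Set.Ioi (0 : ℝ), ∫ ω, g (ω, r) ∂μ.toSphere
          ∂.volumeIoiPow (Module.finrank ℝ E - 1) := integral_prod_symm g hgi
    _ = _ := by
      simp only [Measure.volumeIoiPow, ENNReal.ofReal, g]
      rw [integral_withDensity_eq_integral_smul,
        integral_subtype_comap measurableSet_Ioi fun a ↦
          Real.toNNReal (a ^ (Module.finrank ℝ E - 1)) •
            ∫ ω : sphere (0 : E) 1, f (a • (ω : E)) ∂μ.toSphere,
        setIntegral_congr_fun measurableSet_Ioi fun x hx ↦ ?_]
      · rw [NNReal.smul_def, Real.coe_toNNReal _ (pow_nonneg hx.out.le _)]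
      · exact (measurable_subtype_coe.pow_const _).real_toNNReal

namespace Real.smoothTransition

theorem deriv_nonneg (x : ℝ) : 0 ≤ deriv smoothTransition x :=
  smoothTransition.monotone.deriv_nonneg

theorem deriv_eq_zero_of_nonpos {x : ℝ} (hx : x ≤ 0) : deriv smoothTransition x = 0 :=
  IsLocalMin.deriv_eq_zero (.of_forall fun y ↦ by rw [zero_of_nonpos hx]; exact nonneg y)

theorem deriv_eq_zero_of_one_le {x : ℝ} (hx : 1 ≤ x) : deriv smoothTransition x = 0 :=
  IsLocalMax.deriv_eq_zero (.of_forall fun y ↦ by rw [one_of_one_le hx]; exact le_one y)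

theorem hasDerivAt (x : ℝ) : HasDerivAt smoothTransition (deriv smoothTransition x) x :=
  ((smoothTransition.contDiff (n := 1)).differentiable (by simp) x).hasDerivAt

theorem continuous_deriv : Continuous (deriv smoothTransition) :=
  (smoothTransition.contDiff (n := 1)).continuous_deriv (by simp)

end Real.smoothTransition

/-- The negative of the radial derivative of the cutoff
`x ↦ Real.smoothTransition (1 + n * (R ^ 2 - ‖x‖ ^ 2))`. -/
def radialPeak (R : ℝ) (n : ℕ) (r : ℝ) : ℝ :=
  deriv Real.smoothTransition (1 + n * (R ^ 2 - r ^ 2)) * (n * (2 * r))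

theorem continuous_radialPeak (R : ℝ) (n : ℕ) : Continuous (radialPeak R n) := by
  have := Real.smoothTransition.continuous_deriv
  unfold radialPeak
  fun_prop

theorem radialPeak_nonneg {R : ℝ} {n : ℕ} {r : ℝ} (hr : 0 ≤ r) : 0 ≤ radialPeak R n r :=
  mul_nonneg (Real.smoothTransition.deriv_nonneg _) (by positivity)

theorem radialPeak_eq_zero_of_le {R : ℝ} {n : ℕ} {r : ℝ} (hr : 0 ≤ r) (hrR : r ≤ R) :
    radialPeak R n r = 0 := by
  have : 0 ≤ (n : ℝ) * (R ^ 2 - r ^ 2) :=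
    mul_nonneg n.cast_nonneg (sub_nonneg.2 (pow_le_pow_left₀ hr hrR 2))
  rw [radialPeak, Real.smoothTransition.deriv_eq_zero_of_one_le (by linarith), zero_mul]

theorem radialPeak_eq_zero {R : ℝ} {n : ℕ} {r : ℝ} (h : 1 ≤ n * (r ^ 2 - R ^ 2)) :
    radialPeak R n r = 0 := by
  rw [radialPeak, Real.smoothTransition.deriv_eq_zero_of_nonpos (by linarith), zero_mul]

theorem integral_radialPeak {R : ℝ} {n : ℕ} (hR : 0 < R) (hn : 1 ≤ n) :
    ∫ r in Set.Ioc 0 (R + 1), radialPeak R n r = 1 := by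
  have hn' : (1 : ℝ) ≤ n := by exact_mod_cast hn
  have hd (r : ℝ) : HasDerivAt
      (fun r ↦ -Real.smoothTransition (1 + n * (R ^ 2 - r ^ 2))) (radialPeak R n r) r := by
    have h := (((((hasDerivAt_pow 2 r).const_sub (R ^ 2)).const_mul (n : ℝ)).const_add 1))
    refine ((Real.smoothTransition.hasDerivAt _).comp r h).neg.congr_deriv ?_
    simp [radialPeak]
  have h0 : 1 + (n : ℝ) * (R ^ 2 - (R + 1) ^ 2) ≤ 0 := by nlinarith
  have h1 : 1 ≤ 1 + (n : ℝ) * (R ^ 2 - 0 ^ 2) := by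
    have : 0 ≤ (n : ℝ) * R ^ 2 := by positivity
    linarith
  rw [← intervalIntegral.integral_of_le (by linarith),
    intervalIntegral.integral_eq_sub_of_hasDerivAt (fun r _ ↦ hd r)
      ((continuous_radialPeak R n).intervalIntegrable _ _),
    Real.smoothTransition.zero_of_nonpos h0, Real.smoothTransition.one_of_one_le h1]
  simp

/-- The functions `radialPeak R n` concentrate at `R` as `n` tends to infinity. -/
theorem tendsto_integral_radialPeak_smul {F : Type*} [NormedAddCommGroup F] [NormedSpace ℝ F]
    [CompleteSpace F] {R : ℝ} (hR : 0 < R) {Ψ : ℝ → F} (hΨ : Continuous Ψ) :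
    Tendsto (fun n ↦ ∫ r in Set.Ioi (0 : ℝ), radialPeak R n r • Ψ r) atTop (𝓝 (Ψ R)) := by
  have hs : Set.Ioc 0 (R + 1) ∈ 𝓝 R := Ioc_mem_nhds hR (by linarith)
  have h : Tendsto (fun n ↦ ∫ r in Set.Ioc 0 (R + 1), radialPeak R n r • Ψ r) atTop
      (𝓝 (Ψ R)) := by
    refine tendsto_setIntegral_peak_smul_of_integrableOn_of_tendsto measurableSet_Ioc
      measurableSet_Ioc subset_rfl (mem_nhdsWithin_of_mem_nhds hs) (by simp)
      (.of_forall fun n r hr ↦ radialPeak_nonneg hr.1.le) ?_ ?_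
      (.of_forall fun n ↦ (continuous_radialPeak R n).aestronglyMeasurable)
      (hΨ.continuousOn.integrableOn_Icc.mono_set Set.Ioc_subset_Icc_self)
      (hΨ.continuousAt.mono_left nhdsWithin_le_nhds)
    · intro u hu hRu
      obtain ⟨δ, hδ, hδu⟩ := Metric.isOpen_iff.1 hu R hRu
      obtain ⟨N, hN⟩ := exists_nat_ge (1 / (δ * R))
      rw [Metric.tendstoUniformlyOn_iff]
      intro ε hε
      filter_upwards [eventually_ge_atTop N] with n hn r hr
      suffices radialPeak R n r = 0 by simpa [this]
      rcases le_total r R with hrR | hrR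
      · exact radialPeak_eq_zero_of_le hr.1.1.le hrR
      · have hrδ : R + δ ≤ r := by
          by_contra! hlt
          exact hr.2 (hδu (by rw [mem_ball, Real.dist_eq, abs_lt]; constructor <;> linarith))
        refine radialPeak_eq_zero ?_
        have hn' : 1 / (δ * R) ≤ n := hN.trans (by exact_mod_cast hn)
        rw [div_le_iff₀ (by positivity)] at hn'
        exact hn'.trans (by gcongr; nlinarith)
    · refine tendsto_const_nhds.congr' ?_
      filter_upwards [eventually_ge_atTop 1] with n hn
      exact (integral_radialPeak hR hn).symm
  refine h.congr' ?_
  filter_upwards [eventually_ge_atTop 1] with n hn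
  have hn' : (1 : ℝ) ≤ n := by exact_mod_cast hn
  refine (setIntegral_eq_of_subset_of_forall_sdiff_eq_zero measurableSet_Ioi
    (fun r hr ↦ hr.1) fun r hr ↦ ?_).symm
  have hrR : R + 1 < r := by
    by_contra! hle
    exact hr.2 ⟨hr.1, hle⟩
  have hsq : 1 ≤ r ^ 2 - R ^ 2 := by nlinarith
  rw [radialPeak_eq_zero (one_le_mul_of_one_le_of_one_le hn' hsq), zero_smul]

/-- The divergence theorem on a centered ball, for a globally `C¹` function and one direction. -/
theorem setIntegral_ball_zero_fderiv {E F : Type*} [NormedAddCommGroup E]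
    [InnerProductSpace ℝ E] [FiniteDimensional ℝ E] [Nontrivial E] [MeasurableSpace E]
    [BorelSpace E] [NormedAddCommGroup F] [NormedSpace ℝ F] [CompleteSpace F]
    (μ : Measure E) [μ.IsAddHaarMeasure] {g : E → F} (hg : ContDiff ℝ 1 g) {R : ℝ} (hR : 0 < R)
    (e : E) :
    ∫ x in ball 0 R, fderiv ℝ g x e ∂μ = R ^ (Module.finrank ℝ E - 1) •
      ∫ ω : sphere (0 : E) 1, inner ℝ (ω : E) e • g (R • (ω : E)) ∂μ.toSphere := by
  let χ : ℕ → E → ℝ := fun n x ↦ Real.smoothTransition (1 + n * (R ^ 2 - ‖x‖ ^ 2))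
  have hχ (n : ℕ) : ContDiff ℝ 1 (χ n) :=
    Real.smoothTransition.contDiff.comp
      (contDiff_const.add (contDiff_const.mul (contDiff_const.sub (contDiff_norm_sq ℝ))))
  have hχ' (n : ℕ) (x : E) : fderiv ℝ (χ n) x e =
      -(deriv Real.smoothTransition (1 + n * (R ^ 2 - ‖x‖ ^ 2)) * (n * (2 * inner ℝ x e))) := by
    have h := ((((hasStrictFDerivAt_norm_sq x).hasFDerivAt.const_sub (R ^ 2)).const_mul
      (n : ℝ)).const_add 1)
    have h2 := (Real.smoothTransition.hasDerivAt _).comp_hasFDerivAt x h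
    rw [show fderiv ℝ (χ n) x = _ from h2.fderiv]
    simp
  have hχ0 {n : ℕ} {x : E} (h : 1 ≤ n * (‖x‖ ^ 2 - R ^ 2)) : χ n x = 0 :=
    Real.smoothTransition.zero_of_nonpos (by linarith)
  have hχ0' {n : ℕ} (hn : 1 ≤ n) {x : E} (hx : x ∉ closedBall 0 (R + 1)) : χ n x = 0 := by
    have hn' : (1 : ℝ) ≤ n := by exact_mod_cast hn
    rw [mem_closedBall_zero_iff, not_le] at hx
    exact hχ0 (one_le_mul_of_one_le_of_one_le hn' (by nlinarith))
  have hχ1 (n : ℕ) {x : E} (hx : ‖x‖ ≤ R) : χ n x = 1 := by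
    have : 0 ≤ (n : ℝ) * (R ^ 2 - ‖x‖ ^ 2) :=
      mul_nonneg n.cast_nonneg (sub_nonneg.2 (pow_le_pow_left₀ (norm_nonneg x) hx 2))
    exact Real.smoothTransition.one_of_one_le (by linarith)
  have hsupp {n : ℕ} (hn : 1 ≤ n) : HasCompactSupport (χ n) :=
    .intro (isCompact_closedBall 0 (R + 1)) fun x hx ↦ hχ0' hn hx
  have hgc : Continuous fun x ↦ fderiv ℝ g x e := (hg.continuous_fderiv (by simp)).clm_apply
    continuous_const
  let Ψ : ℝ → F := fun r ↦ r ^ (Module.finrank ℝ E - 1) •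
    ∫ ω : sphere (0 : E) 1, inner ℝ (ω : E) e • g (r • (ω : E)) ∂μ.toSphere
  have hΨ : Continuous Ψ := by
    have hc : Continuous (Function.uncurry fun (r : ℝ) (ω : sphere (0 : E) 1) ↦
        inner ℝ (ω : E) e • g (r • (ω : E))) := by
      have := hg.continuous
      simp only [Function.uncurry_def]
      fun_prop
    have := continuous_parametric_integral_of_continuous (μ := μ.toSphere) hc isCompact_univ
    simp only [Measure.restrict_univ] at this
    exact (continuous_pow _).smul this
  have hlim_left : Tendsto (fun n ↦ ∫ x, χ n x • fderiv ℝ g x e ∂μ) atTop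
      (𝓝 (∫ x in closedBall 0 R, fderiv ℝ g x e ∂μ)) := by
    rw [← integral_indicator measurableSet_closedBall]
    refine tendsto_integral_filter_of_dominated_convergence
      ((closedBall 0 (R + 1)).indicator fun x ↦ ‖fderiv ℝ g x e‖)
      (.of_forall fun n ↦ ((hχ n).continuous.smul hgc).aestronglyMeasurable) ?_ ?_
      (.of_forall fun x ↦ ?_)
    · filter_upwards [eventually_ge_atTop 1] with n hn
      refine .of_forall fun x ↦ ?_
      by_cases hx : x ∈ closedBall 0 (R + 1)
      · rw [Set.indicator_of_mem hx, norm_smul]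
        refine mul_le_of_le_one_left (norm_nonneg _) ?_
        rw [Real.norm_of_nonneg (Real.smoothTransition.nonneg _)]
        exact Real.smoothTransition.le_one _
      · simp [Set.indicator_of_notMem hx, hχ0' hn hx]
    · rw [integrable_indicator_iff measurableSet_closedBall]
      exact hgc.norm.continuousOn.integrableOn_compact (isCompact_closedBall _ _)
    · by_cases hx : x ∈ closedBall 0 R
      · rw [Set.indicator_of_mem hx]
        simp [hχ1 _ (mem_closedBall_zero_iff.1 hx)]
      · rw [Set.indicator_of_notMem hx]
        rw [mem_closedBall_zero_iff, not_le] at hx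
        have hpos : 0 < ‖x‖ ^ 2 - R ^ 2 := by nlinarith
        obtain ⟨N, hN⟩ := exists_nat_ge (1 / (‖x‖ ^ 2 - R ^ 2))
        refine tendsto_const_nhds.congr' ?_
        filter_upwards [eventually_ge_atTop N] with n hn
        have hn' : 1 / (‖x‖ ^ 2 - R ^ 2) ≤ n := hN.trans (by exact_mod_cast hn)
        rw [hχ0 ((div_le_iff₀ hpos).1 hn'), zero_smul]
  have hlim_right : Tendsto (fun n ↦ ∫ x, χ n x • fderiv ℝ g x e ∂μ) atTop (𝓝 (Ψ R)) := by
    refine (tendsto_integral_radialPeak_smul hR hΨ).congr' ?_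
    filter_upwards [eventually_ge_atTop 1] with n hn
    have hχc : Continuous fun x ↦ fderiv ℝ (χ n) x e :=
      ((hχ n).continuous_fderiv (by simp)).clm_apply continuous_const
    have hint : Integrable (fun x ↦ fderiv ℝ (χ n) x e • g x) μ :=
      (hχc.smul hg.continuous).integrable_of_hasCompactSupport
        (((hsupp hn).fderiv_apply ℝ e).smul_right)
    rw [integral_smul_fderiv_eq_neg_fderiv_smul_of_integrable hint
      (((hχ n).continuous.smul hgc).integrable_of_hasCompactSupport (hsupp hn).smul_right)
      (((hχ n).continuous.smul hg.continuous).integrable_of_hasCompactSupport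
        (hsupp hn).smul_right)
      (fun x _ ↦ (hχ n).differentiable (by simp) x) (fun x _ ↦ hg.differentiable (by simp) x),
      integral_eq_setIntegral_Ioi_integral_sphere μ hint, ← integral_neg]
    refine setIntegral_congr_fun measurableSet_Ioi fun r hr ↦ ?_
    have hω (ω : sphere (0 : E) 1) : fderiv ℝ (χ n) (r • (ω : E)) e • g (r • (ω : E)) =
        (-radialPeak R n r) • (inner ℝ (ω : E) e • g (r • (ω : E))) := by
      rw [hχ', smul_smul, norm_smul, norm_eq_of_mem_sphere ω, mul_one, Real.norm_eq_abs, sq_abs,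
        real_inner_smul_left, radialPeak]
      congr 1
      ring
    simp only [Ψ, hω, integral_smul]
    rw [smul_comm, neg_smul, smul_neg, neg_neg, smul_comm]
  refine Eq.trans ?_ (tendsto_nhds_unique hlim_left hlim_right)
  refine setIntegral_congr_set (ae_eq_of_subset_of_measure_ge ball_subset_closedBall ?_
    measurableSet_ball.nullMeasurableSet measure_closedBall_lt_top.ne)
  rw [Measure.addHaar_closedBall_eq_addHaar_ball]

/-- The divergence theorem on a ball, for one direction: the integral of `∂g/∂e` over the ball is
the integral of `⟪n, e⟫ g` over its boundary, with `n` the outward unit normal. -/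
theorem setIntegral_ball_fderiv {E F : Type*} [NormedAddCommGroup E]
    [InnerProductSpace ℝ E] [FiniteDimensional ℝ E] [Nontrivial E] [MeasurableSpace E]
    [BorelSpace E] [NormedAddCommGroup F] [NormedSpace ℝ F] [CompleteSpace F]
    (μ : Measure E) [μ.IsAddHaarMeasure] {c : E} {R : ℝ} (hR : 0 < R) {g : E → F} {U : Set E}
    (hU : IsOpen U) (hUB : closedBall c R ⊆ U) (hg : ContDiffOn ℝ 1 g U) (e : E) :
    ∫ x in ball c R, fderiv ℝ g x e ∂μ = R ^ (Module.finrank ℝ E - 1) •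
      ∫ ω : sphere (0 : E) 1, inner ℝ (ω : E) e • g (c + R • (ω : E)) ∂μ.toSphere := by
  obtain ⟨δ, hδ, hδU⟩ := (isCompact_closedBall c R).exists_cthickening_subset_open hU hUB
  rw [cthickening_closedBall hδ.le hR.le] at hδU
  let χ : ContDiffBump c := ⟨R, δ + R, hR, by linarith⟩
  have hχg : ContDiff ℝ 1 fun x ↦ χ x • g x := by
    rw [contDiff_iff_contDiffAt]
    intro x
    by_cases hx : x ∈ U
    · exact χ.contDiff.contDiffAt.smul (hg.contDiffAt (hU.mem_nhds hx))
    · have hx' : x ∉ tsupport χ := fun h ↦ hx (hδU (by rwa [χ.tsupport_eq] at h))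
      refine (contDiffAt_const (c := 0)).congr_of_eventuallyEq ?_
      filter_upwards [notMem_tsupport_iff_eventuallyEq.1 hx'] with y hy
      simp [hy]
  have h := setIntegral_ball_zero_fderiv μ (hχg.comp (contDiff_const.add contDiff_id)) hR e
    (g := fun x ↦ χ (c + x) • g (c + x))
  have hmem (ω : sphere (0 : E) 1) : c + R • (ω : E) ∈ closedBall c R := by
    simp [norm_smul, abs_of_pos hR]
  have hval (ω : sphere (0 : E) 1) : χ (c + R • (ω : E)) = 1 :=
    χ.one_of_mem_closedBall (hmem ω)
  simp only [hval, one_smul] at h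
  rw [← h]
  have hpre : (fun x ↦ c + x) ⁻¹' ball c R = ball 0 R := by
    ext x; simp
  rw [← hpre, ← (measurePreserving_add_left μ c).setIntegral_preimage_emb
    (measurableEmbedding_addLeft c), hpre]
  refine setIntegral_congr_fun measurableSet_ball fun x hx ↦ ?_
  have hx' : c + x ∈ ball c R := by simpa using hx
  have heq : (fun y ↦ χ y • g y) =ᶠ[𝓝 (c + x)] g := by
    filter_upwards [isOpen_ball.mem_nhds hx'] with y hy
    rw [χ.one_of_mem_closedBall (ball_subset_closedBall hy), one_smul]
  simp only [fderiv_comp_add_left (f := fun y ↦ χ y • g y), heq.fderiv_eq]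

instance : (volume : Measure ℍ[ℝ]).IsAddHaarMeasure :=
  inferInstanceAs (stdOrthonormalBasis ℝ ℍ[ℝ]).toBasis.addHaar.IsAddHaarMeasure

theorem Quaternion.sum_inner_smul_eq (q : ℍ[ℝ]) :
    inner ℝ q 1 • (1 : ℍ[ℝ]) + inner ℝ q qI • qI + inner ℝ q qJ • qJ + inner ℝ q qK • qK = q := by
  have hI : qI.re = 0 ∧ qI.imI = 1 ∧ qI.imJ = 0 ∧ qI.imK = 0 := ⟨rfl, rfl, rfl, rfl⟩
  have hJ : qJ.re = 0 ∧ qJ.imI = 0 ∧ qJ.imJ = 1 ∧ qJ.imK = 0 := ⟨rfl, rfl, rfl, rfl⟩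
  have hK : qK.re = 0 ∧ qK.imI = 0 ∧ qK.imJ = 0 ∧ qK.imK = 1 := ⟨rfl, rfl, rfl, rfl⟩
  simp only [Quaternion.inner_def]
  ext <;> simp [hI, hJ, hK]

theorem integral_add_four {α F : Type*} [MeasurableSpace α] [NormedAddCommGroup F]
    [NormedSpace ℝ F] {μ : Measure α} {f₁ f₂ f₃ f₄ : α → F} (h₁ : Integrable f₁ μ)
    (h₂ : Integrable f₂ μ) (h₃ : Integrable f₃ μ) (h₄ : Integrable f₄ μ) :
    ∫ x, (f₁ x + f₂ x + f₃ x + f₄ x) ∂μ =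
      ∫ x, f₁ x ∂μ + ∫ x, f₂ x ∂μ + ∫ x, f₃ x ∂μ + ∫ x, f₄ x ∂μ := by
  rw [← integral_add' h₁ h₂, ← integral_add' (h₁.add h₂) h₃,
    ← integral_add' ((h₁.add h₂).add h₃) h₄]
  rfl

/-- **Quaternionic Green integral formula (ball case).**
`∫_{B(c,R)} ((D_r u)·v + u·(D_l v)) dV = ∫_{∂B(c,R)} u·n·v dS`. -/
theorem quaternionic_green_ball (c : ℍ[ℝ]) (R : ℝ) (hR : 0 < R)
    (u v : ℍ[ℝ] → ℍ[ℝ]) (U : Set ℍ[ℝ]) (hU : IsOpen U) (hUB : closedBall c R ⊆ U)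
    (hu : ContDiffOn ℝ 1 u U) (hv : ContDiffOn ℝ 1 v U) :
    ∫ q in ball c R, (Dr u q * v q + u q * Dl v q)
      = R ^ 3 • (∫ ω : sphere (0 : ℍ[ℝ]) 1,
          u (c + R • (ω : ℍ[ℝ])) * (ω : ℍ[ℝ]) * v (c + R • (ω : ℍ[ℝ]))
            ∂(volume : Measure ℍ[ℝ]).toSphere) := by
  let g (e q : ℍ[ℝ]) : ℍ[ℝ] := u q * e * v q
  have hg (e : ℍ[ℝ]) : ContDiffOn ℝ 1 (g e) U := (hu.mul contDiffOn_const).mul hv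
  have hvol (e : ℍ[ℝ]) : IntegrableOn (fun q ↦ fderiv ℝ (g e) q e) (ball c R) :=
    ((((hg e).continuousOn_fderiv_of_isOpen hU le_rfl).clm_apply
      continuousOn_const).mono hUB |>.integrableOn_compact (isCompact_closedBall c R)).mono_set
        ball_subset_closedBall
  have hmem (ω : sphere (0 : ℍ[ℝ]) 1) : c + R • (ω : ℍ[ℝ]) ∈ U :=
    hUB (by simp [norm_smul, abs_of_pos hR])
  have hsurf (e : ℍ[ℝ]) : Integrable
      (fun ω : sphere (0 : ℍ[ℝ]) 1 ↦ inner ℝ (ω : ℍ[ℝ]) e • g e (c + R • (ω : ℍ[ℝ])))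
      (volume : Measure ℍ[ℝ]).toSphere := by
    have : Continuous fun ω : sphere (0 : ℍ[ℝ]) 1 ↦ g e (c + R • (ω : ℍ[ℝ])) :=
      (hg e).continuousOn.comp_continuous (by fun_prop) hmem
    exact ((continuous_subtype_val.inner (𝕜 := ℝ) continuous_const).smul
      this).integrable_of_hasCompactSupport (.of_compactSpace _)
  have hdiv (e : ℍ[ℝ]) := setIntegral_ball_fderiv volume hR hU hUB (hg e) e
  rw [Quaternion.finrank_eq_four, Nat.add_one_sub_one] at hdiv
  have hpt : ∀ q ∈ ball c R, Dr u q * v q + u q * Dl v q =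
      fderiv ℝ (g 1) q 1 + fderiv ℝ (g qI) q qI + fderiv ℝ (g qJ) q qJ + fderiv ℝ (g qK) q qK := by
    intro q hq
    have hqU : U ∈ 𝓝 q := hU.mem_nhds (hUB (ball_subset_closedBall hq))
    have hud : DifferentiableAt ℝ u q := (hu.contDiffAt hqU).differentiableAt (by simp)
    have hvd : DifferentiableAt ℝ v q := (hv.contDiffAt hqU).differentiableAt (by simp)
    have h (e : ℍ[ℝ]) : fderiv ℝ (g e) q e =
        fderiv ℝ u q e * e * v q + u q * (e * fderiv ℝ v q e) := by
      have := (hud.hasFDerivAt.mul_const' e).mul' hvd.hasFDerivAt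
      rw [show fderiv ℝ (g e) q = _ from this.fderiv]
      simp [mul_assoc, add_comm]
    rw [h, h, h, h, Dr, Dl, mul_one, one_mul]
    noncomm_ring
  rw [setIntegral_congr_fun measurableSet_ball hpt,
    integral_add_four (hvol 1) (hvol qI) (hvol qJ) (hvol qK), hdiv, hdiv, hdiv, hdiv,
    ← smul_add, ← smul_add, ← smul_add,
    ← integral_add_four (hsurf 1) (hsurf qI) (hsurf qJ) (hsurf qK)]
  congr 2 with ω : 1
  have hsum (a b : ℍ[ℝ]) : a * (ω : ℍ[ℝ]) * b = _ :=
    congrArg (a * · * b) (Quaternion.sum_inner_smul_eq (ω : ℍ[ℝ])).symm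
  rw [hsum]
  simp only [g, mul_add, add_mul, mul_smul_comm, smul_mul_assoc]
end
end

section
/- Let Ω ⊆ ℍ be a bounded open set and let f : ℍ → ℍ be continuously differentiable on Ω. If f is weak F-regular on Ω, i.e. ∫_Ω (D_r φ)(q)·f(q) dV(q) = 0 for every test function φ on Ω, then f is F-regular in the classical sense: D_l f = 0 at every point of Ω. -/
open MeasureTheory Metric Filter
open scoped Quaternion Topology

noncomputable section

theorem integrable_smul_of_continuousOn {X F : Type*} [TopologicalSpace X] [MeasurableSpace X]
    [OpensMeasurableSpace X] {μ : Measure X} [IsFiniteMeasureOnCompacts μ]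
    [NormedAddCommGroup F] [NormedSpace ℝ F] {s : Set X} {g : X → ℝ} {h : X → F}
    (hs : IsOpen s) (hg : Continuous g) (hgc : HasCompactSupport g) (hgs : tsupport g ⊆ s)
    (hh : ContinuousOn h s) : Integrable (fun x ↦ g x • h x) μ :=
  ((hg.continuousOn.smul hh).continuous_of_tsupport_subset hs
    ((tsupport_smul_subset_left g h).trans hgs)).integrable_of_hasCompactSupport
    (hgc.smul_right (f' := h))

theorem integrable_fderiv_smul_of_continuousOn {X F : Type*} [NormedAddCommGroup X]
    [NormedSpace ℝ X] [MeasurableSpace X] [OpensMeasurableSpace X] {μ : Measure X}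
    [IsFiniteMeasureOnCompacts μ] [NormedAddCommGroup F] [NormedSpace ℝ F] {s : Set X}
    {g : X → ℝ} {h : X → F} (hs : IsOpen s) (hg : ContDiff ℝ 1 g) (hgc : HasCompactSupport g)
    (hgs : tsupport g ⊆ s) (hh : ContinuousOn h s) (v : X) :
    Integrable (fun x ↦ fderiv ℝ g x v • h x) μ :=
  integrable_smul_of_continuousOn hs (hg.continuous_fderiv_apply one_ne_zero |>.comp
    (continuous_id.prodMk continuous_const)) (hgc.fderiv_apply ℝ v)
    ((tsupport_fderiv_apply_subset ℝ v).trans hgs) hh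

/-- Integration by parts against a compactly supported function, for a function which is
only `C¹` on an open set containing the support. -/
theorem integral_smul_fderiv_eq_neg_of_contDiffOn {X F : Type*} [NormedAddCommGroup X]
    [NormedSpace ℝ X] [FiniteDimensional ℝ X] [MeasurableSpace X] [BorelSpace X] {μ : Measure X}
    [μ.IsAddHaarMeasure] [NormedAddCommGroup F] [NormedSpace ℝ F] {s : Set X}
    {g : X → ℝ} {h : X → F} (hs : IsOpen s) (hg : ContDiff ℝ 1 g) (hgc : HasCompactSupport g)
    (hgs : tsupport g ⊆ s) (hh : ContDiffOn ℝ 1 h s) (v : X) :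
    ∫ x, g x • fderiv ℝ h x v ∂μ = -∫ x, fderiv ℝ g x v • h x ∂μ :=
  integral_smul_fderiv_eq_neg_fderiv_smul_of_integrable
    (integrable_fderiv_smul_of_continuousOn hs hg hgc hgs hh.continuousOn v)
    (integrable_smul_of_continuousOn hs hg.continuous hgc hgs
      ((hh.continuousOn_fderiv_of_isOpen hs le_rfl).clm_apply continuousOn_const))
    (integrable_smul_of_continuousOn hs hg.continuous hgc hgs hh.continuousOn)
    (fun _ _ ↦ hg.differentiable one_ne_zero _)
    (fun _ hx ↦ (hh.contDiffAt (hs.mem_nhds (hgs hx))).differentiableAt one_ne_zero)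

theorem integral_add_add_add {X F : Type*} [MeasurableSpace X] {μ : Measure X}
    [NormedAddCommGroup F] [NormedSpace ℝ F] {a b c d : X → F} (ha : Integrable a μ)
    (hb : Integrable b μ) (hc : Integrable c μ) (hd : Integrable d μ) :
    ∫ x, (a x + b x + c x + d x) ∂μ = ∫ x, a x ∂μ + ∫ x, b x ∂μ + ∫ x, c x ∂μ + ∫ x, d x ∂μ := by
  rw [integral_add (f := fun x ↦ a x + b x + c x) ((ha.add hb).add hc) hd,
    integral_add (f := fun x ↦ a x + b x) (ha.add hb) hc, integral_add ha hb]

instance isAddHaarMeasure_volume_quaternion : (volume : Measure ℍ[ℝ]).IsAddHaarMeasure :=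
  inferInstanceAs (stdOrthonormalBasis ℝ ℍ[ℝ]).toBasis.addHaar.IsAddHaarMeasure

theorem continuousOn_Dl {s : Set ℍ[ℝ]} {f : ℍ[ℝ] → ℍ[ℝ]} (hs : IsOpen s)
    (hf : ContDiffOn ℝ 1 f s) : ContinuousOn (Dl f) s := by
  have h := hf.continuousOn_fderiv_of_isOpen hs le_rfl
  unfold Dl
  fun_prop

theorem Dr_eq_zero_of_notMem_tsupport {φ : ℍ[ℝ] → ℍ[ℝ]} {q : ℍ[ℝ]} (hq : q ∉ tsupport φ) :
    Dr φ q = 0 := by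
  simp [Dr, fderiv_of_notMem_tsupport ℝ hq]

theorem Dr_smul_one {g : ℍ[ℝ] → ℝ} (hg : Differentiable ℝ g) (q : ℍ[ℝ]) :
    Dr (fun q ↦ g q • 1) q = fderiv ℝ g q 1 • 1 + fderiv ℝ g q qI • qI + fderiv ℝ g q qJ • qJ
      + fderiv ℝ g q qK • qK := by
  simp [Dr, fderiv_smul_const (hg q)]

/-- The left and right Fueter operators are formally adjoint, tested on real functions. -/
theorem integral_smul_Dl_eq_neg {s : Set ℍ[ℝ]} {f : ℍ[ℝ] → ℍ[ℝ]} {g : ℍ[ℝ] → ℝ} (hs : IsOpen s)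
    (hg : ContDiff ℝ 1 g) (hgc : HasCompactSupport g) (hgs : tsupport g ⊆ s)
    (hf : ContDiffOn ℝ 1 f s) :
    ∫ q, g q • Dl f q = -∫ q, Dr (fun q ↦ g q • 1) q * f q := by
  have hD (v : ℍ[ℝ]) : Integrable fun q ↦ g q • (v * fderiv ℝ f q v) :=
    integrable_smul_of_continuousOn hs hg.continuous hgc hgs (continuousOn_const.mul
      ((hf.continuousOn_fderiv_of_isOpen hs le_rfl).clm_apply continuousOn_const))
  have hG (v : ℍ[ℝ]) : Integrable fun q ↦ fderiv ℝ g q v • (v * f q) :=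
    integrable_fderiv_smul_of_continuousOn hs hg hgc hgs
      (continuousOn_const.mul hf.continuousOn) v
  have parts (v : ℍ[ℝ]) :
      ∫ q, g q • (v * fderiv ℝ f q v) = -∫ q, fderiv ℝ g q v • (v * f q) := by
    simp only [← mul_smul_comm]
    rw [integral_const_mul_of_integrable (integrable_smul_of_continuousOn hs hg.continuous hgc hgs
        ((hf.continuousOn_fderiv_of_isOpen hs le_rfl).clm_apply continuousOn_const)),
      integral_const_mul_of_integrable
        (integrable_fderiv_smul_of_continuousOn hs hg hgc hgs hf.continuousOn v),
      integral_smul_fderiv_eq_neg_of_contDiffOn hs hg hgc hgs hf v, mul_neg]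
  have hl (q : ℍ[ℝ]) : g q • Dl f q = g q • (1 * fderiv ℝ f q 1) + g q • (qI * fderiv ℝ f q qI)
      + g q • (qJ * fderiv ℝ f q qJ) + g q • (qK * fderiv ℝ f q qK) := by
    simp only [Dl, smul_add, one_mul]
  have hr (q : ℍ[ℝ]) : Dr (fun q ↦ g q • 1) q * f q = fderiv ℝ g q 1 • (1 * f q)
      + fderiv ℝ g q qI • (qI * f q) + fderiv ℝ g q qJ • (qJ * f q)
      + fderiv ℝ g q qK • (qK * f q) := by
    simp only [Dr_smul_one (hg.differentiable one_ne_zero), add_mul, smul_mul_assoc]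
  simp only [hl, hr]
  rw [integral_add_add_add (hD 1) (hD qI) (hD qJ) (hD qK),
    integral_add_add_add (hG 1) (hG qI) (hG qJ) (hG qK), parts, parts, parts, parts]
  abel

theorem IsTestFunction.smul_one {s : Set ℍ[ℝ]} {g : ℍ[ℝ] → ℝ} (hg : ContDiff ℝ (⊤ : ℕ∞) g)
    (hgc : HasCompactSupport g) (hgs : tsupport g ⊆ s) :
    IsTestFunction (fun q ↦ g q • 1) s where
  smooth := hg.smul contDiff_const
  compact_supp := hgc.smul_right (f' := fun _ ↦ (1 : ℍ[ℝ]))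
  supp_subset := (tsupport_smul_subset_left g fun _ ↦ (1 : ℍ[ℝ])).trans hgs

/-- **Weak F-regular `C¹` functions are F-regular.** If `∫_Ω (D_r φ)·f dV = 0` for every
test function `φ` on `Ω`, then `D_l f = 0` on `Ω`. -/
theorem weak_F_regular_is_F_regular (Ω : Set ℍ[ℝ]) (hΩ : IsOpen Ω)
    (hΩb : Bornology.IsBounded Ω) (f : ℍ[ℝ] → ℍ[ℝ]) (hf : ContDiffOn ℝ 1 f Ω)
    (hweak : ∀ φ : ℍ[ℝ] → ℍ[ℝ], IsTestFunction φ Ω → ∫ q in Ω, Dr φ q * f q = 0) :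
    ∀ q ∈ Ω, Dl f q = 0 := by
  have hcont := continuousOn_Dl hΩ hf
  have hae : ∀ᵐ q, q ∈ Ω → Dl f q = 0 := by
    refine hΩ.ae_eq_zero_of_integral_contDiff_smul_eq_zero
      (hcont.locallyIntegrableOn hΩ.measurableSet) fun g hg hgc hgs ↦ ?_
    have hg1 : ContDiff ℝ 1 g := hg.of_le (by exact_mod_cast le_top)
    have htest := IsTestFunction.smul_one hg hgc hgs
    rw [integral_smul_Dl_eq_neg hΩ hg1 hgc hgs hf,
      ← setIntegral_eq_integral_of_forall_compl_eq_zero fun q hq ↦ ?_, hweak _ htest, neg_zero]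
    rw [Dr_eq_zero_of_notMem_tsupport fun h ↦ hq (htest.supp_subset h), zero_mul]
  exact Measure.eqOn_open_of_ae_eq ((ae_restrict_iff' hΩ.measurableSet).2 hae) hΩ hcont
    continuousOn_const
end
end

section
/- For every fixed p ∈ ℍ, the function q ↦ E(q,p) is real-differentiable at every q ∈ ℍ ∖ {p}, and it is both left and right F-regular there: D_l(E(·,p))(q) = 0 and D_r(E(·,p))(q) = 0 for all q ≠ p. -/
open MeasureTheory Metric Filter
open scoped Quaternion Topology

noncomputable section

theorem E_eq_smul_star (x p : ℍ[ℝ]) :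
    E x p = ((2 * Real.pi ^ 2)⁻¹ * ((‖x - p‖ ^ 2) ^ 2)⁻¹) • star (x - p) := by
  have h : (x - p)⁻¹ = (‖x - p‖ ^ 2)⁻¹ • star (x - p) := by
    rw [pow_two, ← Quaternion.normSq_eq_norm_mul_self, Quaternion.inv_def]
  rw [E, h, smul_smul, mul_assoc, ← mul_inv, ← pow_two]

/-- The real derivative of the Cauchy–Fueter kernel off its singularity. -/
theorem hasFDerivAt_E {p q : ℍ[ℝ]} (hq : q ≠ p) :
    ∃ L : ℍ[ℝ] →L[ℝ] ℍ[ℝ], HasFDerivAt (fun x => E x p) L q ∧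
      ∀ v, L v = (2 * Real.pi ^ 2)⁻¹ •
        (((‖q - p‖ ^ 2) ^ 2)⁻¹ • star v
          - (4 * inner ℝ (q - p) v * ((‖q - p‖ ^ 2) ^ 3)⁻¹) • star (q - p)) := by
  have hn : ‖q - p‖ ≠ 0 := norm_ne_zero_iff.mpr (sub_ne_zero.mpr hq)
  have hsub : HasFDerivAt (fun x : ℍ[ℝ] => x - p) (ContinuousLinearMap.id ℝ ℍ[ℝ]) q :=
    (hasFDerivAt_id q).sub_const p
  have : StarModule ℝ ℍ[ℝ] := ⟨fun r a => by rw [Quaternion.star_smul, star_trivial r]⟩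
  have hinv := (hasDerivAt_inv (pow_ne_zero 2 (pow_ne_zero 2 hn))).comp_hasFDerivAt q
    (hsub.norm_sq.pow 2)
  have h := (hinv.const_mul (2 * Real.pi ^ 2)⁻¹).smul hsub.star
  simp only [E_eq_smul_star]
  refine ⟨_, h, fun v => ?_⟩
  simp only [Function.comp_apply, ContinuousLinearMap.comp_id, add_apply,
    smul_apply, ContinuousLinearMap.smulRight_apply, innerSL_apply_apply,
    ContinuousLinearEquiv.coe_coe, starL'_apply]
  generalize star (q - p) = u
  match_scalars <;> simp <;> field_simp
  ring

@[simp] theorem qI_re : qI.re = 0 := rfl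
@[simp] theorem qI_imI : qI.imI = 1 := rfl
@[simp] theorem qI_imJ : qI.imJ = 0 := rfl
@[simp] theorem qI_imK : qI.imK = 0 := rfl
@[simp] theorem qJ_re : qJ.re = 0 := rfl
@[simp] theorem qJ_imI : qJ.imI = 0 := rfl
@[simp] theorem qJ_imJ : qJ.imJ = 1 := rfl
@[simp] theorem qJ_imK : qJ.imK = 0 := rfl
@[simp] theorem qK_re : qK.re = 0 := rfl
@[simp] theorem qK_imI : qK.imI = 0 := rfl
@[simp] theorem qK_imJ : qK.imJ = 0 := rfl
@[simp] theorem qK_imK : qK.imK = 1 := rfl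

theorem norm_sq_eq_sum_sq (w : ℍ[ℝ]) :
    ‖w‖ ^ 2 = w.re ^ 2 + w.imI ^ 2 + w.imJ ^ 2 + w.imK ^ 2 := by
  rw [pow_two, ← Quaternion.normSq_eq_norm_mul_self, Quaternion.normSq_def']

/-- **The Cauchy–Fueter kernel is F-regular off the singularity.** For fixed `p`, the
function `q ↦ E(q,p)` is real-differentiable at each `q ≠ p` and is both left and right
F-regular there. -/
theorem E_is_F_regular (p q : ℍ[ℝ]) (hq : q ≠ p) :
    DifferentiableAt ℝ (fun x => E x p) q ∧
      Dl (fun x => E x p) q = 0 ∧ Dr (fun x => E x p) q = 0 := by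
  obtain ⟨L, hL, hLv⟩ := hasFDerivAt_E hq
  have hn : ‖q - p‖ ^ 2 ≠ 0 := pow_ne_zero 2 (norm_ne_zero_iff.mpr (sub_ne_zero.mpr hq))
  refine ⟨hL.differentiableAt, ?_, ?_⟩
  all_goals
    simp only [Dl, Dr, hL.fderiv, hLv]
    generalize q - p = w at hn
    rw [norm_sq_eq_sum_sq] at hn ⊢
    ext <;> simp [Quaternion.inner_def] <;> field_simp <;> ring
end
end

section
/- Let f : ℍ → ℍ be continuous on a neighborhood of p ∈ ℍ. Then the surface integrals of E(·,p)·n·f over the spheres of radius ε centered at p converge to f(p) as ε → 0⁺: lim_{ε→0⁺} ε³·∫_{ω∈S³} E(p+εω, p)·ω·f(p+εω) dσ(ω) = f(p), where the outward unit normal at q = p + εω is n(q) = ω and all products are quaternion products. -/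
open MeasureTheory Metric Filter
open scoped Quaternion Topology

noncomputable section

theorem volume_toSphere_real_univ_quaternion :
    (volume : Measure ℍ[ℝ]).toSphere.real Set.univ = 2 * Real.pi ^ 2 := by
  have hball : (volume : Measure ℍ[ℝ]) (ball 0 1) = ENNReal.ofReal (Real.pi ^ 2 / 2) := by
    have h := InnerProductSpace.volume_ball_of_dim_even (E := ℍ[ℝ]) (k := 2)
      (by rw [Quaternion.finrank_eq_four]) 0 1
    simpa [Nat.factorial] using h
  rw [Measure.toSphere_real_apply_univ, Quaternion.finrank_eq_four, measureReal_def, hball,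
    ENNReal.toReal_ofReal (by positivity)]
  push_cast
  ring

theorem E_mul_normal {ε : ℝ} (hε : 0 < ε) (p : ℍ[ℝ]) (ω : sphere (0 : ℍ[ℝ]) 1) :
    E (p + ε • (ω : ℍ[ℝ])) p * (ω : ℍ[ℝ]) =
      (((2 * Real.pi ^ 2)⁻¹ * (ε ^ 3)⁻¹ : ℝ) : ℍ[ℝ]) := by
  have hω : (ω : ℍ[ℝ]) ≠ 0 := ne_zero_of_mem_unit_sphere ω
  have hinv : (ε • (ω : ℍ[ℝ]))⁻¹ = ε⁻¹ • (ω : ℍ[ℝ])⁻¹ :=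
    inv_eq_of_mul_eq_one_right (by
      rw [smul_mul_smul_comm, mul_inv_cancel₀ hε.ne', mul_inv_cancel₀ hω, one_smul])
  rw [E, add_sub_cancel_left, norm_smul, norm_eq_of_mem_sphere, mul_one, Real.norm_eq_abs, sq_abs,
    hinv, smul_mul_assoc, smul_mul_assoc, inv_mul_cancel₀ hω, smul_smul,
    ← Algebra.algebraMap_eq_smul_one, Quaternion.algebraMap_def]
  congr 1
  field_simp

theorem tendsto_integral_toSphere_comp_add_smul (p : ℍ[ℝ]) (f : ℍ[ℝ] → ℍ[ℝ]) (U : Set ℍ[ℝ])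
    (hU : IsOpen U) (hp : p ∈ U) (hf : ContinuousOn f U) :
    Tendsto (fun ε : ℝ => ∫ ω : sphere (0 : ℍ[ℝ]) 1, f (p + ε • (ω : ℍ[ℝ]))
        ∂(volume : Measure ℍ[ℝ]).toSphere)
      (𝓝[>] 0) (𝓝 ((2 * Real.pi ^ 2) • f p)) := by
  have hfp : ContinuousAt f p := hf.continuousAt (hU.mem_nhds hp)
  obtain ⟨r, hr, hrU⟩ := Metric.isOpen_iff.1 hU p hp
  obtain ⟨s, hs, hsf⟩ := Metric.continuousAt_iff.1 hfp 1 one_pos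
  have hdist {ε : ℝ} (hε : 0 < ε) (ω : sphere (0 : ℍ[ℝ]) 1) :
      dist (p + ε • (ω : ℍ[ℝ])) p = ε := by
    simp [dist_eq_norm, norm_smul, abs_of_pos hε]
  rw [← volume_toSphere_real_univ_quaternion, ← integral_const]
  refine tendsto_integral_filter_of_dominated_convergence (fun _ => ‖f p‖ + 1) ?_ ?_
    (integrable_const _) ?_
  · filter_upwards [Ioo_mem_nhdsGT hr] with ε hε
    refine Continuous.aestronglyMeasurable (hf.comp_continuous (by fun_prop) fun ω => hrU ?_)
    rw [mem_ball, hdist hε.1]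
    exact hε.2
  · filter_upwards [Ioo_mem_nhdsGT hs] with ε hε
    refine .of_forall fun ω => ?_
    have h : dist (f (p + ε • (ω : ℍ[ℝ]))) (f p) < 1 := hsf (by rw [hdist hε.1]; exact hε.2)
    rw [dist_eq_norm] at h
    linarith [norm_le_norm_add_norm_sub' (f (p + ε • (ω : ℍ[ℝ]))) (f p)]
  · refine .of_forall fun ω => hfp.tendsto.comp (tendsto_nhdsWithin_of_tendsto_nhds ?_)
    have h : Continuous fun ε : ℝ => p + ε • (ω : ℍ[ℝ]) := by fun_prop
    simpa using h.tendsto 0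

/-- **Sphere integrals of `E·n·f` reproduce `f(p)`.** If `f` is continuous near `p`,
then `ε³·∫_{S³} E(p+εω,p)·ω·f(p+εω) dσ(ω) → f(p)` as `ε → 0⁺`. -/
theorem tendsto_sphere_integral_E (p : ℍ[ℝ]) (f : ℍ[ℝ] → ℍ[ℝ]) (U : Set ℍ[ℝ])
    (hU : IsOpen U) (hp : p ∈ U) (hf : ContinuousOn f U) :
    Tendsto (fun ε : ℝ => ε ^ 3 • (∫ ω : sphere (0 : ℍ[ℝ]) 1,
        E (p + ε • (ω : ℍ[ℝ])) p * (ω : ℍ[ℝ]) * f (p + ε • (ω : ℍ[ℝ]))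
          ∂(volume : Measure ℍ[ℝ]).toSphere))
      (𝓝[>] 0) (𝓝 (f p)) := by
  have h := (tendsto_integral_toSphere_comp_add_smul p f U hU hp hf).const_smul
    (2 * Real.pi ^ 2)⁻¹
  rw [inv_smul_smul₀ (by positivity)] at h
  refine h.congr' ?_
  filter_upwards [self_mem_nhdsWithin] with ε (hε : 0 < ε)
  simp_rw [E_mul_normal hε, Quaternion.coe_mul_eq_smul]
  rw [integral_smul, smul_smul]
  congr 1
  field_simp
end
end

section
/- Let Ω ⊆ ℍ be a bounded open set, let φ be a test function on Ω, and let p ∈ Ω. Then ∫_Ω (D_r φ)(q)·E(q,p) dV(q) = −φ(p). -/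
open MeasureTheory Metric Filter
open scoped Quaternion Topology

noncomputable section

/-- Integration by parts against a one-sided multiplication by a fixed quaternion. -/
lemma integral_mul_mul_fderiv_eq_neg {f g : ℍ[ℝ] → ℍ[ℝ]} (hf : ContDiff ℝ 1 f)
    (hfc : HasCompactSupport f) (hg : ContDiff ℝ 1 g) (v : ℍ[ℝ]) :
    ∫ q, f q * (v * fderiv ℝ g q v) = -∫ q, fderiv ℝ f q v * v * g q := by
  have hf' : Continuous fun q => fderiv ℝ f q v :=
    (hf.continuous_fderiv one_ne_zero).clm_apply continuous_const
  have hg' : Continuous fun q => fderiv ℝ g q v :=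
    (hg.continuous_fderiv one_ne_zero).clm_apply continuous_const
  have hfc' : HasCompactSupport fun q => fderiv ℝ f q v := hfc.fderiv_apply ℝ v
  have key := integral_bilinear_hasFDerivAt_right_eq_neg_left_of_integrable
    (μ := (volume : Measure ℍ[ℝ])) (f := f) (f' := fderiv ℝ f)
    (g := fun q => v * g q) (g' := fun q => v • fderiv ℝ g q) (v := v)
    (B := ContinuousLinearMap.mul ℝ ℍ[ℝ])
    ((hf'.mul (continuous_const.mul hg.continuous)).integrable_of_hasCompactSupport
      hfc'.mul_right)
    ((hf.continuous.mul (continuous_const.mul hg')).integrable_of_hasCompactSupport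
      hfc.mul_right)
    ((hf.continuous.mul (continuous_const.mul hg.continuous)).integrable_of_hasCompactSupport
      hfc.mul_right)
    (fun q _ => (hf.differentiable one_ne_zero q).hasFDerivAt)
    (fun q _ => (hg.differentiable one_ne_zero q).hasFDerivAt.const_mul v)
  simpa [mul_assoc] using key

lemma continuous_Dr {f : ℍ[ℝ] → ℍ[ℝ]} (hf : ContDiff ℝ 1 f) : Continuous (Dr f) := by
  have (v : ℍ[ℝ]) : Continuous fun q => fderiv ℝ f q v :=
    (hf.continuous_fderiv one_ne_zero).clm_apply continuous_const
  exact (((this 1).add ((this qI).mul continuous_const)).add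
    ((this qJ).mul continuous_const)).add ((this qK).mul continuous_const)

lemma support_Dr_subset (f : ℍ[ℝ] → ℍ[ℝ]) : Function.support (Dr f) ⊆ tsupport f := by
  intro q hq
  by_contra h
  have h0 : fderiv ℝ f q = 0 := by
    by_contra h'
    exact h (support_fderiv_subset ℝ h')
  exact hq (by simp [Dr, h0])

/-- The left and right Fueter operators are formally adjoint up to sign. -/
lemma integral_Dr_mul_eq_neg_integral_mul_Dl {f g : ℍ[ℝ] → ℍ[ℝ]} (hf : ContDiff ℝ 1 f)
    (hfc : HasCompactSupport f) (hg : ContDiff ℝ 1 g) :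
    ∫ q, Dr f q * g q = -∫ q, f q * Dl g q := by
  have hf' (v : ℍ[ℝ]) : Integrable fun q => fderiv ℝ f q v * v * g q :=
    ((((hf.continuous_fderiv one_ne_zero).clm_apply continuous_const).mul
      continuous_const).mul hg.continuous).integrable_of_hasCompactSupport
      ((hfc.fderiv_apply ℝ v).mul_right.mul_right)
  have hg' (v : ℍ[ℝ]) : Integrable fun q => f q * (v * fderiv ℝ g q v) :=
    (hf.continuous.mul (continuous_const.mul
      ((hg.continuous_fderiv one_ne_zero).clm_apply
        continuous_const))).integrable_of_hasCompactSupport hfc.mul_right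
  have e1 : ∀ q, Dr f q * g q = fderiv ℝ f q 1 * 1 * g q + fderiv ℝ f q qI * qI * g q
      + fderiv ℝ f q qJ * qJ * g q + fderiv ℝ f q qK * qK * g q := fun q => by
    simp only [Dr, add_mul, mul_one]
  have e2 : ∀ q, f q * Dl g q = f q * (1 * fderiv ℝ g q 1) + f q * (qI * fderiv ℝ g q qI)
      + f q * (qJ * fderiv ℝ g q qJ) + f q * (qK * fderiv ℝ g q qK) := fun q => by
    simp only [Dl, mul_add, one_mul]
  simp_rw [e1, e2]
  have i1 : Integrable fun q => fderiv ℝ f q 1 * 1 * g q + fderiv ℝ f q qI * qI * g q :=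
    (hf' 1).add (hf' qI)
  have i2 : Integrable fun q => f q * (1 * fderiv ℝ g q 1) + f q * (qI * fderiv ℝ g q qI) :=
    (hg' 1).add (hg' qI)
  have j1 : Integrable fun q => fderiv ℝ f q 1 * 1 * g q + fderiv ℝ f q qI * qI * g q
      + fderiv ℝ f q qJ * qJ * g q := i1.add (hf' qJ)
  have j2 : Integrable fun q => f q * (1 * fderiv ℝ g q 1) + f q * (qI * fderiv ℝ g q qI)
      + f q * (qJ * fderiv ℝ g q qJ) := i2.add (hg' qJ)
  rw [integral_add j1 (hf' qK), integral_add i1 (hf' qJ),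
    integral_add (hf' 1) (hf' qI), integral_add j2 (hg' qK),
    integral_add i2 (hg' qJ), integral_add (hg' 1) (hg' qI)]
  simp only [integral_mul_mul_fderiv_eq_neg hf hfc hg]
  abel

/-- The kernel `E(q,0)` with its singularity removed; the parameter `c → ∞` recovers `E(q,0)`. -/
def regularizedE (c : ℝ) (q : ℍ[ℝ]) : ℍ[ℝ] :=
  ((2 * Real.pi ^ 2)⁻¹ * c ^ 4 * ((1 + c ^ 2 * ‖q‖ ^ 2) ^ 2)⁻¹) • star q

/-- The image of `regularizedE 1` under the left Fueter operator. -/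
def fueterBump (q : ℍ[ℝ]) : ℝ := 2 / Real.pi ^ 2 * ((1 + ‖q‖ ^ 2) ^ 3)⁻¹

instance : StarModule ℝ ℍ[ℝ] := ⟨fun r q => by ext <;> simp⟩

lemma contDiff_regularizedE (c : ℝ) : ContDiff ℝ 1 (regularizedE c) := by
  unfold regularizedE
  have h : ContDiff ℝ 1 fun q : ℍ[ℝ] => (1 + c ^ 2 * ‖q‖ ^ 2) ^ 2 :=
    (contDiff_const.add (contDiff_const.mul (contDiff_norm_sq ℝ))).pow 2
  exact (contDiff_const.mul (h.inv fun q => by positivity)).smul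
    (starL' ℝ : ℍ[ℝ] ≃L[ℝ] ℍ[ℝ]).contDiff

lemma fderiv_regularizedE (c : ℝ) (q v : ℍ[ℝ]) :
    fderiv ℝ (regularizedE c) q v = ((2 * Real.pi ^ 2)⁻¹ * c ^ 4) •
      (((1 + c ^ 2 * ‖q‖ ^ 2) ^ 2)⁻¹ • star v -
        (4 * c ^ 2 * inner ℝ q v * ((1 + c ^ 2 * ‖q‖ ^ 2) ^ 3)⁻¹) • star q) := by
  have h1 : HasDerivAt (fun s : ℝ => (2 * Real.pi ^ 2)⁻¹ * c ^ 4 * ((1 + c ^ 2 * s) ^ 2)⁻¹)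
      ((2 * Real.pi ^ 2)⁻¹ * c ^ 4 * (-2 * c ^ 2 * ((1 + c ^ 2 * ‖q‖ ^ 2) ^ 3)⁻¹)) (‖q‖ ^ 2) := by
    have h0 : 1 + c ^ 2 * ‖q‖ ^ 2 ≠ 0 := by positivity
    have := (((((hasDerivAt_id (‖q‖ ^ 2)).const_mul (c ^ 2)).const_add 1).pow 2).inv
      (pow_ne_zero 2 h0)).const_mul ((2 * Real.pi ^ 2)⁻¹ * c ^ 4)
    convert! this using 1
    simp
    field_simp
  have h2 := h1.comp_hasFDerivAt q (hasFDerivAt_id q).norm_sq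
  have h3 := h2.smul (starL' ℝ : ℍ[ℝ] ≃L[ℝ] ℍ[ℝ]).hasFDerivAt
  have h4 : HasFDerivAt (regularizedE c) _ q := h3
  rw [h4.fderiv]
  ext <;> simp <;> ring

lemma Dl_regularizedE (c : ℝ) (q : ℍ[ℝ]) :
    Dl (regularizedE c) q = ((c ^ 4 * fueterBump (c • q) : ℝ) : ℍ[ℝ]) := by
  have hn : ‖q‖ ^ 2 = q.re ^ 2 + q.imI ^ 2 + q.imJ ^ 2 + q.imK ^ 2 := by
    rw [sq, ← Quaternion.normSq_eq_norm_mul_self, Quaternion.normSq_def']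
  have hb : fueterBump (c • q) = 2 / Real.pi ^ 2 * ((1 + c ^ 2 * ‖q‖ ^ 2) ^ 3)⁻¹ := by
    simp [fueterBump, norm_smul, mul_pow]
  have hi : ((1 + c ^ 2 * ‖q‖ ^ 2) ^ 2)⁻¹
      = (1 + c ^ 2 * ‖q‖ ^ 2) * ((1 + c ^ 2 * ‖q‖ ^ 2) ^ 3)⁻¹ := by field_simp
  have hp : 2 / Real.pi ^ 2 = 4 * (2 * Real.pi ^ 2)⁻¹ := by field_simp; norm_num
  rw [hb, hp]
  simp only [Dl, fderiv_regularizedE, Quaternion.inner_def, hi]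
  generalize ((1 + c ^ 2 * ‖q‖ ^ 2) ^ 3)⁻¹ = D
  generalize (2 * Real.pi ^ 2)⁻¹ = P
  rw [hn]
  have hI : qI.re = 0 ∧ qI.imI = 1 ∧ qI.imJ = 0 ∧ qI.imK = 0 := ⟨rfl, rfl, rfl, rfl⟩
  have hJ : qJ.re = 0 ∧ qJ.imI = 0 ∧ qJ.imJ = 1 ∧ qJ.imK = 0 := ⟨rfl, rfl, rfl, rfl⟩
  have hK : qK.re = 0 ∧ qK.imI = 0 ∧ qK.imJ = 0 ∧ qK.imK = 1 := ⟨rfl, rfl, rfl, rfl⟩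
  ext <;> simp [hI, hJ, hK, -Quaternion.coe_mul, -Quaternion.coe_pow] <;> ring

lemma volume_real_ball_quaternion :
    (volume : Measure ℍ[ℝ]).real (ball 0 1) = Real.pi ^ 2 / 2 := by
  have h : (volume : Measure ℍ[ℝ]) (ball 0 1) = _ :=
    InnerProductSpace.volume_ball_of_dim_even (k := 2)
      (by rw [Quaternion.finrank_eq_four]) (0 : ℍ[ℝ]) 1
  rw [Measure.real, h]
  simp [Nat.factorial, ENNReal.toReal_ofReal (show 0 ≤ Real.pi ^ 2 / 2 by positivity)]

lemma fueterBump_nonneg (q : ℍ[ℝ]) : 0 ≤ fueterBump q := by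
  unfold fueterBump; positivity

lemma integral_fueterBump : ∫ q, fueterBump q = 1 := by
  have h := integral_fun_norm_addHaar (volume : Measure ℍ[ℝ])
    (fun y => 2 / Real.pi ^ 2 * ((1 + y ^ 2) ^ 3)⁻¹)
  have hder : ∀ x ∈ Set.Ici (0 : ℝ), HasDerivAt
      (fun y : ℝ => (2 * Real.pi ^ 2)⁻¹ * (1 - (1 + y ^ 2)⁻¹) ^ 2)
      (x ^ 3 • (2 / Real.pi ^ 2 * ((1 + x ^ 2) ^ 3)⁻¹)) x := by
    intro x _
    have h0 : 1 + x ^ 2 ≠ 0 := by positivity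
    have := ((((((hasDerivAt_id x).pow 2).const_add 1).inv h0).const_sub 1).pow 2).const_mul
      (2 * Real.pi ^ 2)⁻¹
    convert! this using 1
    simp
    field_simp
    ring
  have hlim : Tendsto (fun y : ℝ => (2 * Real.pi ^ 2)⁻¹ * (1 - (1 + y ^ 2)⁻¹) ^ 2) atTop
      (𝓝 ((2 * Real.pi ^ 2)⁻¹ * (1 - 0) ^ 2)) :=
    (((tendsto_const_nhds (x := (1 : ℝ))).sub (tendsto_inv_atTop_zero.comp
      (tendsto_atTop_add_const_left _ 1 (tendsto_pow_atTop two_ne_zero)))).pow 2).const_mul _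
  have hradial := integral_Ioi_of_hasDerivAt_of_nonneg' hder
    (fun x (hx : 0 < x) => by simp only [smul_eq_mul]; positivity) hlim
  rw [Quaternion.finrank_eq_four, volume_real_ball_quaternion, hradial] at h
  refine h.trans ?_
  simp
  field_simp
  norm_num

lemma tendsto_norm_pow_mul_fueterBump :
    Tendsto (fun q : ℍ[ℝ] => ‖q‖ ^ Module.finrank ℝ ℍ[ℝ] * fueterBump q)
      (Bornology.cobounded ℍ[ℝ]) (𝓝 0) := by
  have hz : Tendsto (fun q : ℍ[ℝ] => 2 / Real.pi ^ 2 * (1 + ‖q‖ ^ 2)⁻¹)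
      (Bornology.cobounded ℍ[ℝ]) (𝓝 (2 / Real.pi ^ 2 * 0)) :=
    (tendsto_inv_atTop_zero.comp (tendsto_atTop_add_const_left _ 1
      ((tendsto_pow_atTop two_ne_zero).comp tendsto_norm_cobounded_atTop))).const_mul _
  rw [mul_zero] at hz
  refine squeeze_zero (fun q => mul_nonneg (by positivity) (fueterBump_nonneg q)) (fun q => ?_) hz
  rw [Quaternion.finrank_eq_four, fueterBump]
  have h0 : 0 < 1 + ‖q‖ ^ 2 := by positivity
  have h1 : ‖q‖ ^ 4 ≤ (1 + ‖q‖ ^ 2) ^ 2 := by nlinarith [sq_nonneg ‖q‖]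
  calc ‖q‖ ^ 4 * (2 / Real.pi ^ 2 * ((1 + ‖q‖ ^ 2) ^ 3)⁻¹)
      ≤ (1 + ‖q‖ ^ 2) ^ 2 * (2 / Real.pi ^ 2 * ((1 + ‖q‖ ^ 2) ^ 3)⁻¹) := by gcongr
    _ = 2 / Real.pi ^ 2 * (1 + ‖q‖ ^ 2)⁻¹ := by field_simp

lemma E_zero_right (q : ℍ[ℝ]) :
    E q 0 = ((2 * Real.pi ^ 2)⁻¹ * (‖q‖ ^ 4)⁻¹) • star q := by
  rw [E, sub_zero, Quaternion.inv_def, Quaternion.normSq_eq_norm_mul_self, smul_smul]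
  congr 1
  rw [mul_assoc, ← mul_inv]
  ring_nf

lemma norm_E_zero_right (q : ℍ[ℝ]) : ‖E q 0‖ = (2 * Real.pi ^ 2)⁻¹ * (‖q‖ ^ 3)⁻¹ := by
  rw [E, sub_zero, norm_smul, norm_inv, Real.norm_of_nonneg (by positivity), mul_assoc, ← mul_inv]
  ring_nf

lemma norm_regularizedE_le (c : ℝ) (q : ℍ[ℝ]) : ‖regularizedE c q‖ ≤ ‖E q 0‖ := by
  rcases eq_or_ne q 0 with rfl | hq
  · simp [regularizedE]
  have hq' : 0 < ‖q‖ := norm_pos_iff.2 hq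
  rw [E_zero_right, regularizedE, norm_smul, norm_smul, Real.norm_of_nonneg (by positivity),
    Real.norm_of_nonneg (by positivity), mul_assoc (2 * Real.pi ^ 2)⁻¹]
  refine mul_le_mul_of_nonneg_right (mul_le_mul_of_nonneg_left ?_ (by positivity)) (norm_nonneg (star q))
  rw [← div_eq_mul_inv, div_le_iff₀ (by positivity), inv_mul_eq_div, le_div_iff₀ (by positivity)]
  nlinarith [mul_nonneg (sq_nonneg c) (sq_nonneg ‖q‖)]

lemma tendsto_regularizedE (q : ℍ[ℝ]) :
    Tendsto (fun c => regularizedE c q) atTop (𝓝 (E q 0)) := by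
  rcases eq_or_ne q 0 with rfl | hq
  · simp [regularizedE, E]
  have hq' : 0 < ‖q‖ := norm_pos_iff.2 hq
  have hlim : Tendsto (fun c : ℝ => ((2 * Real.pi ^ 2)⁻¹ * (((c ^ 2)⁻¹ + ‖q‖ ^ 2) ^ 2)⁻¹) • star q)
      atTop (𝓝 (((2 * Real.pi ^ 2)⁻¹ * ((0 + ‖q‖ ^ 2) ^ 2)⁻¹) • star q)) :=
    (((((tendsto_inv_atTop_zero.comp (tendsto_pow_atTop two_ne_zero)).add_const _).pow 2).inv₀
      (by positivity)).const_mul _).smul_const _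
  have he : ((2 * Real.pi ^ 2)⁻¹ * ((0 + ‖q‖ ^ 2) ^ 2)⁻¹) • star q = E q 0 := by
    rw [E_zero_right, zero_add, ← pow_mul]
  rw [he] at hlim
  refine hlim.congr' ?_
  filter_upwards [eventually_gt_atTop 0] with c hc
  rw [regularizedE, mul_assoc]
  congr 2
  field_simp

lemma integrableOn_norm_E_zero_right (R : ℝ) :
    IntegrableOn (fun q : ℍ[ℝ] => ‖E q 0‖) (ball 0 R) := by
  simp_rw [norm_E_zero_right]
  rw [integrableOn_fun_norm_addHaar (volume : Measure ℍ[ℝ])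
    (f := fun y => (2 * Real.pi ^ 2)⁻¹ * (y ^ 3)⁻¹), Quaternion.finrank_eq_four]
  refine (integrableOn_const (C := (2 * Real.pi ^ 2)⁻¹) (by simp)).congr_fun
    (fun y hy => ?_) measurableSet_Ioo
  have : y ≠ 0 := hy.1.ne'
  simp
  field_simp

/-- `E(·,0)` is a fundamental solution of the Fueter operator. -/
lemma integral_Dr_mul_E_zero {f : ℍ[ℝ] → ℍ[ℝ]} (hf : ContDiff ℝ 1 f)
    (hfc : HasCompactSupport f) : ∫ q, Dr f q * E q 0 = -f 0 := by
  have hDc : HasCompactSupport (Dr f) := hfc.mono' (support_Dr_subset f)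
  obtain ⟨M, hM⟩ := hDc.exists_bound_of_continuous (continuous_Dr hf)
  obtain ⟨R, hR⟩ := hDc.isCompact.isBounded.subset_ball 0
  have hlim : Tendsto (fun c => ∫ q, Dr f q * regularizedE c q) atTop
      (𝓝 (∫ q, Dr f q * E q 0)) := by
    refine tendsto_integral_filter_of_dominated_convergence
      ((ball 0 R).indicator fun q => M * ‖E q 0‖) (.of_forall fun c => ?_)
      (.of_forall fun c => .of_forall fun q => ?_)
      ((integrable_indicator_iff measurableSet_ball).2
        ((integrableOn_norm_E_zero_right R).const_mul M))
      (.of_forall fun q => (tendsto_regularizedE q).const_mul _)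
    · exact ((continuous_Dr hf).mul (contDiff_regularizedE c).continuous).aestronglyMeasurable
    · by_cases hq : q ∈ ball 0 R
      · rw [Set.indicator_of_mem hq, norm_mul]
        exact mul_le_mul (hM q) (norm_regularizedE_le c q) (norm_nonneg _)
          ((norm_nonneg _).trans (hM q))
      · rw [Set.indicator_of_notMem hq, image_eq_zero_of_notMem_tsupport fun h => hq (hR h)]
        simp
  have hpeak := tendsto_integral_comp_smul_smul_of_integrable (μ := (volume : Measure ℍ[ℝ]))
    fueterBump_nonneg integral_fueterBump tendsto_norm_pow_mul_fueterBump
    (hf.continuous.integrable_of_hasCompactSupport hfc) hf.continuous.continuousAt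
  refine tendsto_nhds_unique hlim (hpeak.neg.congr fun c => ?_)
  rw [integral_Dr_mul_eq_neg_integral_mul_Dl hf hfc (contDiff_regularizedE c)]
  simp_rw [Dl_regularizedE, Quaternion.finrank_eq_four, Quaternion.mul_coe_eq_smul]

/-- For every test function `φ` on a bounded open `Ω` and interior point `p ∈ Ω`,
`∫_Ω (D_r φ)(q)·E(q,p) dV(q) = −φ(p)`. -/
theorem integral_Dr_testFunction_E (Ω : Set ℍ[ℝ]) (hΩ : IsOpen Ω)
    (hΩb : Bornology.IsBounded Ω) (φ : ℍ[ℝ] → ℍ[ℝ]) (hφ : IsTestFunction φ Ω)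
    (p : ℍ[ℝ]) (hp : p ∈ Ω) :
    ∫ q in Ω, Dr φ q * E q p = -φ p := by
  have hφ1 : ContDiff ℝ 1 φ := hφ.smooth.of_le (by exact_mod_cast le_top)
  rw [setIntegral_eq_integral_of_forall_compl_eq_zero fun q hq => by
    rw [Function.notMem_support.1 fun h => hq (hφ.supp_subset (support_Dr_subset φ h)), zero_mul]]
  rw [← integral_add_right_eq_self _ p]
  have h := integral_Dr_mul_E_zero (f := fun q => φ (q + p))
    (hφ1.comp (contDiff_id.add contDiff_const))
    (hφ.compact_supp.comp_homeomorph (Homeomorph.addRight p))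
  simpa [Dr, E, fderiv_comp_add_right] using h
end
end
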